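/- arXiv:2205.06582 — 7 statements merged into one kernel-verified Lean document; each statement's English description precedes it below -/
import Mathlib

section
/- Let ν > 0 and let V : ℝ → ℝ be measurable with positive part V₊ ∈ L²(ℝ). Then for every N ∈ ℕ and all reals E₁ < E₂ < ⋯ < E_N < 0, each of which is an eigenvalue of −d²/dx² − ν(ν+1)sech²(x) − V on L²(ℝ), one has Σ_{k=1}^{min(N,⌈ν⌉)} (√|E_k| − (ν−k+1))³ + Σ_{k=⌈ν⌉+1}^{N} |E_k|^{3/2} ≤ (3/16) ∫_ℝ V₊(x)² dx. (Here (ν−k+1)² = |E_k(H₀)| with E_k(H₀) = −(ν−k+1)², k = 1, …, ⌈ν⌉, the eigenvalues of the Pöschl–Teller operator −d²/dx² − ν(ν+1)sech²(x).) -/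
open MeasureTheory Real Filter Set
open scoped Topology

/-- `E` is an eigenvalue of the Schrödinger operator `-d²/dx² - W` on `L²(ℝ)`:
there is a nonzero `ψ ∈ L²(ℝ)`, continuously differentiable with `ψ'` locally
absolutely continuous (encoded via a locally integrable a.e.-derivative `ψ''`),
such that `-ψ'' - Wψ = Eψ` almost everywhere. -/
def IsEigenvalue (W : ℝ → ℝ) (E : ℝ) : Prop :=
  ∃ ψ ψ'' : ℝ → ℝ, ψ ≠ 0 ∧ MemLp ψ 2 (volume : Measure ℝ) ∧ ContDiff ℝ 1 ψ ∧
    (∀ a b : ℝ, IntervalIntegrable ψ'' volume a b ∧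
      ∫ x in a..b, ψ'' x = deriv ψ b - deriv ψ a) ∧
    (∀ᵐ x : ℝ ∂volume, -ψ'' x - W x * ψ x = E * ψ x)

/-- clipping to `[-B, B]` -/
noncomputable def clipB (B x : ℝ) : ℝ := max (-B) (min x B)

lemma clipB_abs {B : ℝ} (hB : 0 ≤ B) (x : ℝ) : |clipB B x| ≤ B := by
  unfold clipB
  rw [abs_le]
  exact ⟨le_max_left _ _, max_le (by linarith) (min_le_right _ _)⟩

lemma clipB_lip (B x y : ℝ) : |clipB B x - clipB B y| ≤ |x - y| := by
  unfold clipB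
  refine (abs_max_sub_max_le_max _ _ _ _).trans ?_
  simp only [sub_self, abs_zero]
  refine max_le (abs_nonneg _) ?_
  refine (abs_min_sub_min_le_max _ _ _ _).trans ?_
  simp

lemma clipB_eq {B x : ℝ} (h1 : -B ≤ x) (h2 : x ≤ B) : clipB B x = x := by
  unfold clipB
  rw [min_eq_left h2, max_eq_right h1]

lemma clip_sq_lip {B : ℝ} (hB : 0 ≤ B) (c : ℝ) :
    LipschitzWith (Real.toNNReal (2 * B)) (fun x => c - clipB B x ^ 2) := by
  apply LipschitzWith.of_dist_le_mul
  intro x y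
  rw [Real.dist_eq, Real.dist_eq, Real.coe_toNNReal _ (by linarith)]
  have h1 := clipB_abs hB x
  have h2 := clipB_abs hB y
  have h3 := clipB_lip B x y
  have : c - clipB B x ^ 2 - (c - clipB B y ^ 2)
      = -((clipB B x + clipB B y) * (clipB B x - clipB B y)) := by ring
  rw [this, abs_neg, abs_mul]
  have h4 : |clipB B x + clipB B y| ≤ 2 * B := (abs_add_le _ _).trans (by linarith)
  gcongr

lemma ode_exists {R B : ℝ} (hR : 0 < R) (hB : 0 ≤ B) {W : ℝ → ℝ} (hW : Continuous W)
    (κ c : ℝ) : ∃ F : ℝ → ℝ, F (-R) = κ ∧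
      ∀ t ∈ Icc (-R) R, HasDerivWithinAt F (c - W t - clipB B (F t) ^ 2) (Icc (-R) R) t := by
  obtain ⟨M, hM⟩ := (isCompact_Icc (a := -R) (b := R)).exists_bound_of_continuousOn
    (f := W) hW.continuousOn
  have hM0 : 0 ≤ M := (norm_nonneg _).trans (hM (-R) ⟨le_rfl, by linarith⟩)
  set L : ℝ := |c| + M + B ^ 2 with hL
  have hL0 : 0 ≤ L := by positivity
  have hPL : IsPicardLindelof (fun t x => c - W t - clipB B x ^ 2)
      (⟨-R, ⟨le_rfl, by linarith⟩⟩ : Icc (-R) R) κ (Real.toNNReal (L * (2 * R))) 0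
      (Real.toNNReal L) (Real.toNNReal (2 * B)) := by
    refine ⟨?_, ?_, ?_, ?_⟩
    · intro t _
      exact (clip_sq_lip hB _).lipschitzOnWith
    · intro x _
      exact ((continuous_const.sub hW).sub continuous_const).continuousOn
    · intro t ht x _
      rw [Real.coe_toNNReal _ hL0, Real.norm_eq_abs]
      have h1 := hM t ht
      rw [Real.norm_eq_abs] at h1
      have h2 := sq_le_sq' (abs_le.1 (clipB_abs hB x)).1 (abs_le.1 (clipB_abs hB x)).2
      have h3 := sq_nonneg (clipB B x)
      have h4 := abs_le.1 h1
      have h5 := neg_abs_le c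
      have h6 := le_abs_self c
      rw [abs_le]; constructor <;> nlinarith
    · rw [Real.coe_toNNReal _ hL0, Real.coe_toNNReal _ (by positivity)]
      have : max (R - -R) (-R - -R) = 2 * R := by
        rw [max_eq_left (by linarith)]; ring
      simp only [this, NNReal.coe_zero, sub_zero, le_refl]
  exact hPL.exists_eq_forall_mem_Icc_hasDerivWithinAt₀

/-- `F` solves the Riccati equation on `[-R, R]`. -/
def Ric (R : ℝ) (W : ℝ → ℝ) (L : ℝ) (F : ℝ → ℝ) : Prop :=
  ContinuousOn F (Icc (-R) R) ∧ ∀ x ∈ Icc (-R) R, HasDerivWithinAt F (L ^ 2 - W x - F x ^ 2) (Icc (-R) R) x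

/-- admissible test functions -/
def Adm (R : ℝ) (f : ℝ → ℝ) : Prop :=
  ContDiff ℝ 1 f ∧ ∀ x, x ∉ Ioo (-R) R → f x = 0

/-- quadratic form -/
noncomputable def qf (R : ℝ) (W f : ℝ → ℝ) : ℝ :=
  ∫ x in (-R)..R, (deriv f x ^ 2 - W x * f x ^ 2)

/-- squared norm -/
noncomputable def nf (R : ℝ) (f : ℝ → ℝ) : ℝ := ∫ x in (-R)..R, f x ^ 2

lemma Adm.left {R : ℝ} {f : ℝ → ℝ} (h : Adm R f) : f (-R) = 0 := h.2 _ (by simp)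
lemma Adm.right {R : ℝ} {f : ℝ → ℝ} (h : Adm R f) : f R = 0 := h.2 _ (by simp)
lemma Adm.cont {R : ℝ} {f : ℝ → ℝ} (h : Adm R f) : Continuous f := h.1.continuous
lemma Adm.dcont {R : ℝ} {f : ℝ → ℝ} (h : Adm R f) : Continuous (deriv f) :=
  h.1.continuous_deriv le_rfl
lemma Adm.hasDeriv {R : ℝ} {f : ℝ → ℝ} (h : Adm R f) (x : ℝ) : HasDerivAt f (deriv f x) x :=
  (h.1.differentiable one_ne_zero x).hasDerivAt

lemma ftc_Icc {a b : ℝ} (hab : a ≤ b) {f f' : ℝ → ℝ} 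
    (hd : ∀ x ∈ Icc a b, HasDerivWithinAt f (f' x) (Icc a b) x)
    (hc : ContinuousOn f' (Icc a b)) : ∫ x in a..b, f' x = f b - f a := by
  refine intervalIntegral.integral_eq_sub_of_hasDerivAt_of_le hab
    (fun x hx => (hd x hx).continuousWithinAt) (fun x hx => ?_) ?_
  · exact (hd x (Ioo_subset_Icc_self hx)).hasDerivAt (Icc_mem_nhds hx.1 hx.2)
  · exact ContinuousOn.intervalIntegrable (by rwa [uIcc_of_le hab])

lemma ii {R : ℝ} (hR : 0 < R) {f : ℝ → ℝ} (hf : ContinuousOn f (Icc (-R) R)) :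
    IntervalIntegrable f volume (-R) R :=
  ContinuousOn.intervalIntegrable (by rwa [uIcc_of_le (by linarith)])

lemma qf_eq {R : ℝ} (hR : 0 < R) {W : ℝ → ℝ} (hW : Continuous W) {L : ℝ} {F f : ℝ → ℝ}
    (hF : Ric R W L F) (hf : Adm R f) :
    qf R W f + L ^ 2 * nf R f = ∫ x in (-R)..R, (deriv f x - F x * f x) ^ 2 := by
  have c1 := hf.cont.continuousOn (s := Icc (-R) R)
  have c2 := hf.dcont.continuousOn (s := Icc (-R) R)
  have c3 := hF.1
  have c4 := hW.continuousOn (s := Icc (-R) R)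
  have h0 : ∫ x in (-R)..R, ((L ^ 2 - W x - F x ^ 2) * f x ^ 2 + F x * (2 * f x * deriv f x)) = 0 := by
    rw [ftc_Icc (f := fun x => F x * f x ^ 2) (by linarith)]
    · simp [hf.left, hf.right]
    · intro x hx
      have := (hF.2 x hx).mul (((hf.hasDeriv x).pow 2).hasDerivWithinAt (s := Icc (-R) R))
      refine this.congr_deriv ?_
      simp only [Pi.pow_apply]
      ring
    · fun_prop
  unfold qf nf
  rw [← intervalIntegral.integral_const_mul, ← intervalIntegral.integral_add
    (ii hR (by fun_prop)) (ii hR (by fun_prop)), ← sub_zero (∫ x in (-R)..R, _), ← h0,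
    ← intervalIntegral.integral_sub (ii hR (by fun_prop)) (ii hR (by fun_prop))]
  congr 1; ext x; ring

lemma nf_pos {R : ℝ} (hR : 0 < R) {f : ℝ → ℝ} (hf : Adm R f) (h : f ≠ 0) : 0 < nf R f := by
  obtain ⟨x, hx⟩ := Function.ne_iff.1 h
  have hx' : x ∈ Ioo (-R) R := by
    by_contra hn
    exact hx (hf.2 x hn)
  refine intervalIntegral.integral_pos (by linarith) (hf.cont.pow 2).continuousOn
    (fun y _ => sq_nonneg _) ⟨x, Ioo_subset_Icc_self hx', ?_⟩
  have : f x ≠ 0 := hx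
  positivity

lemma nf_nonneg {R : ℝ} (hR : 0 < R) (f : ℝ → ℝ) : 0 ≤ nf R f :=
  intervalIntegral.integral_nonneg (by linarith) (fun y _ => sq_nonneg _)

lemma qf_ge {R : ℝ} (hR : 0 < R) {W : ℝ → ℝ} (hW : Continuous W) {L : ℝ} {F f : ℝ → ℝ}
    (hF : Ric R W L F) (hf : Adm R f) :
    0 ≤ qf R W f + L ^ 2 * nf R f := by
  rw [qf_eq hR hW hF hf]
  exact intervalIntegral.integral_nonneg (by linarith) (fun y _ => sq_nonneg _)

theorem ground_exists {R : ℝ} (hR : 0 < R) {W : ℝ → ℝ} (hW : Continuous W) {l : ℝ} (hl : 0 < l)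
    {f : ℝ → ℝ} (hf : Adm R f) (hf0 : f ≠ 0) (hq : qf R W f ≤ - l ^ 2 * nf R f) :
    ∃ L F, l ≤ L ∧ Ric R W L F ∧ F (-R) = L ∧ F R = -L := by
  have hn := nf_pos hR hf hf0
  obtain ⟨M, hM⟩ := (isCompact_Icc (a := -R) (b := R)).exists_bound_of_continuousOn
    (f := W) hW.continuousOn
  have hM0 : 0 ≤ M := (norm_nonneg _).trans (hM (-R) ⟨le_rfl, by linarith⟩)
  have hM1 : ∀ x ∈ Icc (-R) R, W x ≤ M := fun x hx => (le_abs_self _).trans (hM x hx)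
  have hM2 : ∀ x ∈ Icc (-R) R, -M ≤ W x := fun x hx => (abs_le.1 (hM x hx)).1
  set K : ℝ := 1 + M + l with hK
  set B : ℝ := K + M + 1 with hBdef
  have hB : 0 ≤ B := by positivity
  choose F hF0 hF using fun κ : ℝ => ode_exists hR hB hW κ (κ ^ 2)
  have hFc : ∀ κ, ContinuousOn (F κ) (Icc (-R) R) := fun κ x hx => (hF κ x hx).continuousWithinAt
  have hFI : ∀ κ, ∀ t ∈ Ico (-R) R,
      HasDerivWithinAt (F κ) (κ ^ 2 - W t - clipB B (F κ t) ^ 2) (Ici t) t := fun κ t ht =>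
    (hF κ t (Ico_subset_Icc_self ht)).mono_of_mem_nhdsWithin (Icc_mem_nhdsGE_of_mem ht)
  -- upper bound
  have hup : ∀ κ ∈ Icc 0 K, ∀ x ∈ Icc (-R) R, F κ x ≤ B := by
    intro κ hκ
    refine image_le_of_deriv_right_lt_deriv_boundary (B := fun _ => B) (B' := fun _ => 0)
      (hFc κ) (hFI κ) ?_ (fun x => hasDerivAt_const _ _) ?_
    · rw [hF0]; linarith [hκ.2]
    · intro x hx h
      rw [h, clipB_eq (by linarith) le_rfl]
      have := hM2 x (Ico_subset_Icc_self hx)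
      have h1 : κ ^ 2 ≤ K ^ 2 := pow_le_pow_left₀ hκ.1 hκ.2 2
      nlinarith
  have hlow : ∀ κ ∈ Icc 0 K, -κ ≤ F κ R → ∀ x ∈ Icc (-R) R, -B ≤ F κ x := by
    intro κ hκ hκR x hx
    by_contra hlt
    push Not at hlt
    have : F κ R ≤ -B := by
      refine image_le_of_deriv_right_lt_deriv_boundary (a := x) (b := R) (B := fun _ => -B) (B' := fun _ => 0)
        ((hFc κ).mono (Icc_subset_Icc_left hx.1)) (fun y hy => hFI κ y ⟨hx.1.trans hy.1, hy.2⟩)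
          hlt.le (fun x => hasDerivAt_const _ _) ?_ ⟨hx.2, le_rfl⟩
      intro y hy h
      rw [h, clipB_eq le_rfl (by linarith)]
      have := hM2 y ⟨hx.1.trans hy.1, hy.2.le⟩
      have h1 : κ ^ 2 ≤ K ^ 2 := pow_le_pow_left₀ hκ.1 hκ.2 2
      nlinarith
    linarith [hκ.2]
  have hric : ∀ κ ∈ Icc 0 K, -κ ≤ F κ R → Ric R W κ (F κ) := by
    intro κ hκ hκR
    refine ⟨hFc κ, fun x hx => ?_⟩
    have := hF κ x hx
    rwa [clipB_eq (hlow κ hκ hκR x hx) (hup κ hκ x hx)] at this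
  have hcont : ContinuousOn (fun κ => F κ R + κ) (Icc (l / 2) K) := by
    refine ContinuousOn.add ?_ continuousOn_id
    intro κ _
    apply ContinuousAt.continuousWithinAt
    have hg : ∀ κ', dist (F κ' R) (F κ R) ≤ gronwallBound (dist κ' κ) (Real.toNNReal (2 * B))
        (|κ' ^ 2 - κ ^ 2| + 0) (R - -R) := by
      intro κ'
      refine dist_le_of_approx_trajectories_ODE (v := fun t x => κ ^ 2 - W t - clipB B x ^ 2)
        (fun t => clip_sq_lip hB _) (hFc κ') (hFI κ') ?_ (hFc κ) (hFI κ) ?_ ?_ R ⟨by linarith, le_rfl⟩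
      · intro t _
        rw [Real.dist_eq]
        apply le_of_eq; congr 1; ring
      · intro t _; simp
      · rw [hF0, hF0]
    have hlim : Tendsto (fun κ' => gronwallBound (dist κ' κ) (Real.toNNReal (2 * B))
        (|κ' ^ 2 - κ ^ 2| + 0) (R - -R)) (𝓝 κ) (𝓝 0) := by
      have hKne : ((Real.toNNReal (2 * B) : NNReal) : ℝ) ≠ 0 := by
        rw [Real.coe_toNNReal _ (by linarith)]
        have : 0 < B := by positivity
        positivity
      simp only [gronwallBound_of_K_ne_0 hKne]
      have : Continuous (fun κ' : ℝ => dist κ' κ * rexp ((Real.toNNReal (2 * B) : NNReal) * (R - -R)) +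
        (|κ' ^ 2 - κ ^ 2| + 0) / (Real.toNNReal (2 * B) : NNReal) * (rexp ((Real.toNNReal (2 * B) : NNReal) * (R - -R)) - 1)) := by
        fun_prop
      have h2 := this.tendsto κ
      simpa using h2
    rw [ContinuousAt, tendsto_iff_dist_tendsto_zero]
    exact squeeze_zero (fun _ => dist_nonneg) hg hlim
  have hKtop : 0 ≤ F K R + K := by
    have : ∀ x ∈ Icc (-R) R, -F K x ≤ 0 := by
      refine image_le_of_deriv_right_lt_deriv_boundary (B := fun _ => 0) (B' := fun _ => 0)
        (hFc K).neg (fun x hx => (hFI K x hx).neg) ?_ (fun x => hasDerivAt_const _ _) ?_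
      · rw [Pi.neg_apply, hF0]; linarith
      · intro x hx h
        have h' : F K x = 0 := by simpa using h
        rw [h', clipB_eq (by linarith) hB]
        have := hM1 x (Ico_subset_Icc_self hx)
        nlinarith
    have := this R ⟨by linarith, le_rfl⟩
    linarith
  have hbot : F (l / 2) R + l / 2 ≤ 0 := by
    by_contra hcon
    push Not at hcon
    have := qf_ge hR hW (hric (l / 2) ⟨by linarith, by linarith⟩ (by linarith)) hf
    nlinarith [mul_pos (mul_pos hl hl) hn]
  obtain ⟨κ, hκ, hκ0⟩ := intermediate_value_Icc (by linarith : l / 2 ≤ K) hcont ⟨hbot, hKtop⟩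
  have hκ0' : F κ R + κ = 0 := hκ0
  have hr := hric κ ⟨by linarith [hκ.1], hκ.2⟩ (by linarith)
  refine ⟨κ, F κ, ?_, hr, hF0 κ, by linarith⟩
  have := qf_ge hR hW hr hf
  by_contra hlt
  push Not at hlt
  have hk0 : 0 < κ := by linarith [hκ.1]
  nlinarith [mul_pos (mul_pos (sub_pos.2 hlt) (by linarith : 0 < l + κ)) hn]


theorem ground_exists_cont {R : ℝ} (hR : 0 < R) {W : ℝ → ℝ} (hW : Continuous W) {l : ℝ} (hl : 0 < l)
    {f : ℝ → ℝ} (hf : Adm R f) (hf0 : f ≠ 0) (hq : qf R W f ≤ - l ^ 2 * nf R f) :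
    ∃ L F, l ≤ L ∧ Continuous F ∧ Ric R W L F ∧ F (-R) = L ∧ F R = -L := by
  obtain ⟨L, F, h1, h2, h3, h4⟩ := ground_exists hR hW hl hf hf0 hq
  have hle : -R ≤ R := by linarith
  have heq : ∀ x ∈ Icc (-R) R, IccExtend hle ((Icc (-R) R).domRestrict F) x = F x := by
    intro x hx
    rw [IccExtend_of_mem _ _ hx]; rfl
  refine ⟨L, IccExtend hle ((Icc (-R) R).domRestrict F), h1, ?_, ⟨?_, ?_⟩, ?_, ?_⟩
  · exact (continuousOn_iff_continuous_domRestrict.1 h2.1).Icc_extend'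
  · exact (continuousOn_iff_continuous_domRestrict.1 h2.1).Icc_extend'.continuousOn
  · intro x hx
    rw [heq x hx]
    exact (h2.2 x hx).congr heq (heq x hx)
  · rw [heq _ ⟨le_rfl, hle⟩, h3]
  · rw [heq _ ⟨hle, le_rfl⟩, h4]

/-- commuted potential -/
def comW (W : ℝ → ℝ) (L : ℝ) (F : ℝ → ℝ) : ℝ → ℝ := fun x => 2 * L ^ 2 - 2 * F x ^ 2 - W x

/-- integrating factor -/
noncomputable def phiF (R : ℝ) (F : ℝ → ℝ) : ℝ → ℝ := fun x => Real.exp (∫ t in (-R)..x, F t)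

/-- solution of `-(g' + F g) = f` -/
noncomputable def gF (R : ℝ) (F f : ℝ → ℝ) : ℝ → ℝ :=
  fun x => -((phiF R F x)⁻¹ * ∫ t in (-R)..x, phiF R F t * f t)

lemma phiF_deriv (R : ℝ) {F : ℝ → ℝ} (hF : Continuous F) (x : ℝ) :
    HasDerivAt (phiF R F) (phiF R F x * F x) x := by
  exact (hF.integral_hasStrictDerivAt (-R) x).hasDerivAt.exp

lemma phiF_cont (R : ℝ) {F : ℝ → ℝ} (hF : Continuous F) : Continuous (phiF R F) :=
  continuous_iff_continuousAt.2 fun x => (phiF_deriv R hF x).continuousAt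

lemma phiF_pos (R : ℝ) (F : ℝ → ℝ) (x : ℝ) : 0 < phiF R F x := Real.exp_pos _

lemma gF_deriv (R : ℝ) {F f : ℝ → ℝ} (hF : Continuous F) (hf : Continuous f) (x : ℝ) :
    HasDerivAt (gF R F f) (-f x - F x * gF R F f x) x := by
  have h1 := (phiF_deriv R hF x).inv (phiF_pos R F x).ne'
  have h2 := (((phiF_cont R hF).mul hf).integral_hasStrictDerivAt (-R) x).hasDerivAt
  have h3 := (h1.mul h2).neg
  refine h3.congr_deriv ?_
  unfold gF
  have := (phiF_pos R F x).ne'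
  simp only [Pi.mul_apply, Pi.inv_apply]
  field_simp
  ring

lemma gF_adm {R : ℝ} {F f : ℝ → ℝ} (hF : Continuous F) (hf : Adm R f)
    (h0 : ∫ t in (-R)..R, phiF R F t * f t = 0) : Adm R (gF R F f) := by
  have hd : deriv (gF R F f) = fun x => -f x - F x * gF R F f x :=
    funext fun x => (gF_deriv R hF hf.cont x).deriv
  have hc : Continuous (gF R F f) :=
    continuous_iff_continuousAt.2 fun x => (gF_deriv R hF hf.cont x).continuousAt
  have hc1 := hf.cont
  refine ⟨?_, ?_⟩
  · rw [contDiff_one_iff_deriv]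
    refine ⟨fun x => (gF_deriv R hF hf.cont x).differentiableAt, ?_⟩
    rw [hd]; fun_prop
  · intro x hx
    have : ∫ t in (-R)..x, phiF R F t * f t = 0 := by
      by_cases hxR : x ≤ -R
      · rw [intervalIntegral.integral_symm, intervalIntegral.integral_zero_ae, neg_zero]
        refine Filter.Eventually.of_forall fun t ht => ?_
        rw [uIoc_of_le hxR] at ht
        rw [hf.2 t (fun h => by linarith [h.1, ht.2]), mul_zero]
      · have hxR' : R ≤ x := by
          by_contra hcon
          exact hx ⟨by linarith, by linarith⟩
        have hii : ∀ a b, IntervalIntegrable (fun t => phiF R F t * f t) volume a b :=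
          fun a b => ((phiF_cont R hF).mul hc1).intervalIntegrable a b
        rw [← intervalIntegral.integral_add_adjacent_intervals (hii (-R) R) (hii R x), h0, zero_add,
          intervalIntegral.integral_zero_ae]
        refine Filter.Eventually.of_forall fun t ht => ?_
        rw [uIoc_of_le hxR'] at ht
        rw [hf.2 t (fun h => by linarith [h.2, ht.1]), mul_zero]
    simp [gF, this]

lemma gF_form {R : ℝ} (hR : 0 < R) {W : ℝ → ℝ} (hW : Continuous W) {L : ℝ} {F f : ℝ → ℝ}
    (hFc : Continuous F) (hF : Ric R W L F) (hf : Adm R f)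
    (h0 : ∫ t in (-R)..R, phiF R F t * f t = 0) {l : ℝ} (hl0 : 0 < l) (hl : l ≤ L)
    (hq : qf R W f ≤ -l ^ 2 * nf R f) :
    qf R (comW W L F) (gF R F f) ≤ -l ^ 2 * nf R (gF R F f) := by
  have hg := gF_adm hFc hf h0
  have hd : ∀ x, deriv (gF R F f) x = -f x - F x * gF R F f x :=
    fun x => (gF_deriv R hFc hf.cont x).deriv
  set g := gF R F f with hgdef
  have c1 := hf.cont
  have c2 := hf.dcont
  have c3 := hg.cont
  have c4 := hg.dcont
  have e1 : qf R (comW W L F) g + L ^ 2 * nf R g = nf R f := by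
    have h0 : ∫ x in (-R)..R, ((L ^ 2 - W x - F x ^ 2) * g x ^ 2 + F x * (2 * g x * deriv g x)) = 0 := by
      rw [ftc_Icc (f := fun x => F x * g x ^ 2) (by linarith)]
      · simp [hg.left, hg.right]
      · intro x hx
        have := (hF.2 x hx).mul (((hg.hasDeriv x).pow 2).hasDerivWithinAt (s := Icc (-R) R))
        refine this.congr_deriv ?_
        simp only [Pi.pow_apply]
        ring
      · fun_prop
    unfold qf nf comW
    rw [← intervalIntegral.integral_const_mul, ← intervalIntegral.integral_add
      (ii hR (by fun_prop)) (ii hR (by fun_prop)), ← add_zero (∫ x in (-R)..R, _), ← h0,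
      ← intervalIntegral.integral_add (ii hR (by fun_prop)) (ii hR (by fun_prop))]
    congr 1; ext x; rw [hd x]; ring
  have e2 : nf R f = ∫ x in (-R)..R, g x * (deriv f x - F x * f x) := by
    have h0 : ∫ x in (-R)..R, (deriv f x * g x + f x * deriv g x) = 0 := by
      rw [ftc_Icc (f := fun x => f x * g x) (by linarith)]
      · simp [hg.left, hg.right]
      · intro x hx
        exact ((hf.hasDeriv x).mul (hg.hasDeriv x)).hasDerivWithinAt
      · fun_prop
    unfold nf
    rw [← add_zero (∫ x in (-R)..R, _), ← h0,
      ← intervalIntegral.integral_add (ii hR (by fun_prop)) (ii hR (by fun_prop))]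
    congr 1; ext x; rw [hd x]; ring
  have e3 := qf_eq hR hW hF hf
  set A := ∫ x in (-R)..R, (deriv f x - F x * f x) ^ 2 with hA
  have hAle : A ≤ (L ^ 2 - l ^ 2) * nf R f := by linarith
  have hG := nf_nonneg hR g
  have hN := nf_nonneg hR f
  have key : ∀ t : ℝ, 2 * t * nf R f ≤ A + t ^ 2 * nf R g := by
    intro t
    have h1 : 0 ≤ ∫ x in (-R)..R, (deriv f x - F x * f x - t * g x) ^ 2 :=
      intervalIntegral.integral_nonneg (by linarith) (fun y _ => sq_nonneg _)
    have h2 : ∫ x in (-R)..R, (deriv f x - F x * f x - t * g x) ^ 2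
        = A - 2 * t * nf R f + t ^ 2 * nf R g := by
      rw [e2, hA]
      unfold nf
      rw [← intervalIntegral.integral_const_mul, ← intervalIntegral.integral_const_mul,
        ← intervalIntegral.integral_sub (ii hR (by fun_prop)) (ii hR (by fun_prop)),
        ← intervalIntegral.integral_add (ii hR (by fun_prop)) (ii hR (by fun_prop))]
      congr 1; ext x; ring
    linarith
  have hfin : nf R f ≤ (L ^ 2 - l ^ 2) * nf R g := by
    have hc : 0 ≤ L ^ 2 - l ^ 2 := by nlinarith
    rcases hc.eq_or_lt with hc0 | hc0
    · rw [← hc0] at hAle ⊢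
      by_contra hcon
      push Not at hcon
      have hNp : 0 < nf R f := by linarith
      have hA0 : A ≤ 0 := by linarith
      -- choose t small
      have hk := key (nf R f / (nf R g + 1))
      have hG1 : 0 < nf R g + 1 := by linarith
      have ht : 0 < nf R f / (nf R g + 1) := by positivity
      have h3 : 2 * nf R f ≤ nf R f / (nf R g + 1) * nf R g := by
        by_contra h4
        push Not at h4
        nlinarith
      have h5 : nf R f / (nf R g + 1) * nf R g ≤ nf R f := by
        rw [div_mul_eq_mul_div, div_le_iff₀ hG1]; nlinarith
      linarith
    · have hk := key (L ^ 2 - l ^ 2)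
      nlinarith
  linarith

/-- there is an `n`-dimensional space of test functions with energy at most `-l^2` -/
def Tst (R : ℝ) (W : ℝ → ℝ) (n : ℕ) (l : ℝ) : Prop :=
  ∃ S : Submodule ℝ (ℝ → ℝ), n ≤ Module.finrank ℝ S ∧
    ∀ f ∈ S, Adm R f ∧ qf R W f ≤ -l ^ 2 * nf R f

theorem Tst.commute {R : ℝ} (hR : 0 < R) {W : ℝ → ℝ} (hW : Continuous W) {L : ℝ} {F : ℝ → ℝ}
    (hFc : Continuous F) (hF : Ric R W L F) {n : ℕ} {l : ℝ} (hl0 : 0 < l) (hl : l ≤ L)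
    (h : Tst R W (n + 1) l) : Tst R (comW W L F) n l := by
  obtain ⟨S, hS, hS2⟩ := h
  have : Module.Finite ℝ S := Module.finite_of_finrank_pos (by omega)
  have hii : ∀ f ∈ S, ∀ a b, IntervalIntegrable (fun t => phiF R F t * f t) volume a b :=
    fun f hf a b => ((phiF_cont R hFc).mul (hS2 f hf).1.cont).intervalIntegrable a b
  have hadd : ∀ f ∈ S, ∀ g ∈ S, ∀ x, ∫ t in (-R)..x, phiF R F t * (f + g) t
      = (∫ t in (-R)..x, phiF R F t * f t) + ∫ t in (-R)..x, phiF R F t * g t := by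
    intro f hf g hg x
    rw [← intervalIntegral.integral_add (hii f hf _ _) (hii g hg _ _)]
    congr 1; ext t; simp; ring
  have hsmul : ∀ (c : ℝ) (f : ℝ → ℝ) (x : ℝ), ∫ t in (-R)..x, phiF R F t * (c • f) t
      = c * ∫ t in (-R)..x, phiF R F t * f t := by
    intro c f x
    rw [← intervalIntegral.integral_const_mul]
    congr 1; ext t; simp; ring
  let ell : S →ₗ[ℝ] ℝ :=
    { toFun := fun f => ∫ t in (-R)..R, phiF R F t * (f : ℝ → ℝ) t
      map_add' := fun f g => hadd f f.2 g g.2 R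
      map_smul' := fun c f => hsmul c f R }
  let T : S →ₗ[ℝ] (ℝ → ℝ) :=
    { toFun := fun f => gF R F f
      map_add' := fun f g => by
        ext x
        have := hadd f f.2 g g.2 x
        simp only [gF, Pi.add_apply, Submodule.coe_add] at this ⊢
        rw [this]; ring
      map_smul' := fun c f => by
        ext x
        have := hsmul c f x
        simp only [gF, Pi.smul_apply, Submodule.coe_smul, RingHom.id_apply, smul_eq_mul] at this ⊢
        rw [this]; ring }
  have hT : Function.Injective T := by
    rw [← LinearMap.ker_eq_bot, LinearMap.ker_eq_bot']
    intro f hf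
    have hg0 : gF R F f = 0 := hf
    ext x
    have := gF_deriv R hFc (hS2 f f.2).1.cont x
    rw [hg0] at this
    have h2 := this.unique (hasDerivAt_const x (0 : ℝ))
    simpa using h2
  refine ⟨Submodule.map T (LinearMap.ker ell), ?_, ?_⟩
  · rw [← LinearEquiv.finrank_eq (Submodule.equivMapOfInjective T hT (LinearMap.ker ell))]
    have h1 := LinearMap.finrank_range_add_finrank_ker ell
    have h2 := Submodule.finrank_le (LinearMap.range ell)
    rw [Module.finrank_self] at h2
    omega
  · rintro _ ⟨f, hf, rfl⟩
    have hf0 : ∫ t in (-R)..R, phiF R F t * (f : ℝ → ℝ) t = 0 := hf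
    exact ⟨gF_adm hFc (hS2 f f.2).1 hf0,
      gF_form hR hW hFc hF (hS2 f f.2).1 hf0 hl0 hl (hS2 f f.2).2⟩

theorem Tst.mono {R : ℝ} (hR : 0 < R) {W W' : ℝ → ℝ} (hW : Continuous W) (hW' : Continuous W')
    (hle : ∀ x, W x ≤ W' x) {n : ℕ} {l : ℝ}
    (h : Tst R W n l) : Tst R W' n l := by
  obtain ⟨S, hS, hS2⟩ := h
  refine ⟨S, hS, fun f hf => ⟨(hS2 f hf).1, le_trans ?_ (hS2 f hf).2⟩⟩
  have c1 := (hS2 f hf).1.cont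
  have c2 := (hS2 f hf).1.dcont
  refine intervalIntegral.integral_mono (by linarith) (ii hR (by fun_prop)) (ii hR (by fun_prop)) ?_
  intro x
  have := mul_le_mul_of_nonneg_right (hle x) (sq_nonneg (f x))
  simp only
  linarith

theorem Tst.ground {R : ℝ} (hR : 0 < R) {W : ℝ → ℝ} (hW : Continuous W) {l : ℝ} (hl : 0 < l)
    (h : Tst R W 1 l) :
    ∃ L F, l ≤ L ∧ Continuous F ∧ Ric R W L F ∧ F (-R) = L ∧ F R = -L := by
  obtain ⟨S, hS, hS2⟩ := h
  have : Module.Finite ℝ S := Module.finite_of_finrank_pos (by omega)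
  have : Nontrivial S := Module.nontrivial_of_finrank_pos (R := ℝ) (by omega)
  obtain ⟨f, hf⟩ := exists_ne (0 : S)
  exact ground_exists_cont hR hW hl (hS2 f f.2).1 (fun h => hf (Subtype.ext h)) (hS2 f f.2).2


theorem Tst.le {R : ℝ} (hR : 0 < R) {W : ℝ → ℝ} (hW : Continuous W) {L : ℝ} {F : ℝ → ℝ}
    (hF : Ric R W L F) (hL : 0 < L) {n : ℕ} {l : ℝ} 
    (h : Tst R W (n + 1) l) : l ≤ L := by
  obtain ⟨S, hS, hS2⟩ := h
  have : Module.Finite ℝ S := Module.finite_of_finrank_pos (by omega)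
  have : Nontrivial S := Module.nontrivial_of_finrank_pos (R := ℝ) (by omega)
  obtain ⟨f, hf⟩ := exists_ne (0 : S)
  have hn := nf_pos hR (hS2 f f.2).1 (fun h => hf (Subtype.ext h))
  have h1 := qf_ge hR hW hF (hS2 f f.2).1
  have h2 := (hS2 f f.2).2
  by_contra hlt
  push Not at hlt
  nlinarith [mul_pos (mul_pos (sub_pos.2 hlt) (by linarith : 0 < l + L)) hn]

/-- the functional `∫ (W - ν(ν+1) sech²)²`, expanded -/
noncomputable def Jf (R ν : ℝ) (W : ℝ → ℝ) : ℝ :=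
  (∫ x in (-R)..R, (W x ^ 2 - 2 * (ν * (ν + 1)) * (1 - Real.tanh x ^ 2) * W x))
    + 4 / 3 * (ν * (ν + 1)) ^ 2

lemma tanh_deriv' (x : ℝ) : HasDerivAt Real.tanh (1 - Real.tanh x ^ 2) x := by
  have h := (Real.hasDerivAt_sinh x).div (Real.hasDerivAt_cosh x) (Real.cosh_pos x).ne'
  have h2 : Real.tanh = Real.sinh / Real.cosh := by
    ext y; simp [Real.tanh_eq_sinh_div_cosh]
  rw [h2]
  refine h.congr_deriv ?_
  have := (Real.cosh_pos x).ne'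
  simp only [Pi.div_apply]
  field_simp

lemma tanh_cont' : Continuous Real.tanh :=
  continuous_iff_continuousAt.2 fun x => (tanh_deriv' x).continuousAt

lemma tanh_sq_lt' (x : ℝ) : Real.tanh x ^ 2 < 1 := by
  rw [Real.tanh_eq_sinh_div_cosh, div_pow, div_lt_one (pow_pos (Real.cosh_pos x) 2)]
  have := Real.cosh_sq x
  linarith

lemma tanh_pos' {x : ℝ} (hx : 0 < x) : 0 < Real.tanh x := by
  rw [Real.tanh_eq_sinh_div_cosh]
  exact div_pos (Real.sinh_pos_iff.2 hx) (Real.cosh_pos x)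

lemma poly_step {ν L T : ℝ} (hν : 0 ≤ ν) (hT1 : T ≤ 1) (hT0 : 0 ≤ T) :
    -(16 / 3) * L ^ 3 + 4 * ν * (2 * L ^ 2 * T + 2 * ν ^ 2 * T ^ 3 / 3 + 2 * ν * (1 - T ^ 2) * L)
      - 16 / 3 * ν ^ 3 ≤ -(16 / 3) * (L - ν) ^ 3 := by
  have h1 : 0 ≤ L ^ 2 - ν * L * (1 + T) + ν ^ 2 * (1 + T + T ^ 2) / 3 := by
    nlinarith [sq_nonneg (L - ν * (1 + T) / 2), mul_nonneg (sq_nonneg ν) (sq_nonneg (1 - T))]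
  have h2 : 0 ≤ ν * ((1 - T) * (L ^ 2 - ν * L * (1 + T) + ν ^ 2 * (1 + T + T ^ 2) / 3)) :=
    mul_nonneg hν (mul_nonneg (by linarith) h1)
  have h3 : 0 ≤ ν * (L - ν) ^ 2 := mul_nonneg hν (sq_nonneg _)
  nlinarith

theorem Jf_step {R : ℝ} (hR : 0 < R) {W : ℝ → ℝ} (hW : Continuous W) {L : ℝ} {F : ℝ → ℝ}
    (hFc : Continuous F) (hF : Ric R W L F) (h1 : F (-R) = L) (h2 : F R = -L)
    {ν : ℝ} (hν : 0 ≤ ν) :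
    Jf R (ν - 1) (comW W L F) + 16 / 3 * (L - ν) ^ 3 ≤ Jf R ν W := by
  have ct := tanh_cont'
  have hQ : ∫ x in (-R)..R, (4 * (L ^ 2 - F x ^ 2) * (L ^ 2 - W x - F x ^ 2)
      + 4 * ν * ((1 - Real.tanh x ^ 2) * (L ^ 2 + ν ^ 2 * Real.tanh x ^ 2)
        - ν * ((1 - Real.tanh x ^ 2) * (L ^ 2 - W x - F x ^ 2)
          - 2 * Real.tanh x * (1 - Real.tanh x ^ 2) * F x)))
      = -(16 / 3) * L ^ 3 + 4 * ν * (2 * L ^ 2 * Real.tanh R + 2 * ν ^ 2 * Real.tanh R ^ 3 / 3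
        + 2 * ν * (1 - Real.tanh R ^ 2) * L) := by
    rw [ftc_Icc (f := fun x => 4 * (L ^ 2 * F x - F x ^ 3 / 3) + 4 * ν * (L ^ 2 * Real.tanh x
      + ν ^ 2 * (Real.tanh x ^ 3 / 3) - ν * ((1 - Real.tanh x ^ 2) * F x))) (by linarith)]
    · simp only [h1, h2, Real.tanh_neg]; ring
    · intro x hx
      have hf := hF.2 x hx
      have ht := (tanh_deriv' x).hasDerivWithinAt (s := Icc (-R) R)
      have := (((hf.const_mul (L ^ 2)).sub ((hf.pow 3).div_const 3)).const_mul 4).add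
        ((((ht.const_mul (L ^ 2)).add (((ht.pow 3).div_const 3).const_mul (ν ^ 2))).sub
          (((((ht.pow 2).const_sub 1)).mul hf).const_mul ν)).const_mul (4 * ν))
      refine this.congr_deriv ?_
      simp only [Pi.pow_apply]
      push_cast
      ring
    · fun_prop
  have hD : (∫ x in (-R)..R, ((comW W L F x) ^ 2 - 2 * ((ν - 1) * (ν - 1 + 1)) * (1 - Real.tanh x ^ 2) * comW W L F x))
      - (∫ x in (-R)..R, (W x ^ 2 - 2 * (ν * (ν + 1)) * (1 - Real.tanh x ^ 2) * W x))
      ≤ -(16 / 3) * L ^ 3 + 4 * ν * (2 * L ^ 2 * Real.tanh R + 2 * ν ^ 2 * Real.tanh R ^ 3 / 3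
        + 2 * ν * (1 - Real.tanh R ^ 2) * L) := by
    rw [← hQ]
    unfold comW
    rw [← intervalIntegral.integral_sub (ii hR (by fun_prop)) (ii hR (by fun_prop))]
    refine intervalIntegral.integral_mono (by linarith) (ii hR (by fun_prop)) (ii hR (by fun_prop)) ?_
    intro x
    have hs : 0 ≤ ν * ((1 - Real.tanh x ^ 2) * (F x + ν * Real.tanh x) ^ 2) :=
      mul_nonneg hν (mul_nonneg (by linarith [tanh_sq_lt' x]) (sq_nonneg _))
    simp only
    nlinarith
  have hT := tanh_sq_lt' R
  have hT0 := tanh_pos' hR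
  have := poly_step (L := L) hν (T := Real.tanh R) (by nlinarith) hT0.le
  unfold Jf
  nlinarith

lemma int_sech4 (R : ℝ) (hR : 0 < R) : ∫ x in (-R)..R, (1 - Real.tanh x ^ 2) ^ 2
    = 2 * Real.tanh R - 2 / 3 * Real.tanh R ^ 3 := by
  have ct := tanh_cont'
  rw [ftc_Icc (f := fun x => Real.tanh x - Real.tanh x ^ 3 / 3) (by linarith)]
  · simp only [Real.tanh_neg]; ring
  · intro x hx
    have ht := (tanh_deriv' x).hasDerivWithinAt (s := Icc (-R) R)
    refine (ht.sub ((ht.pow 3).div_const 3)).congr_deriv ?_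
    push_cast
    ring
  · fun_prop

lemma Jf_eq {R : ℝ} (hR : 0 < R) {W : ℝ → ℝ} (hW : Continuous W) (ν : ℝ) :
    Jf R ν W = (∫ x in (-R)..R, (W x - (ν * (ν + 1)) * (1 - Real.tanh x ^ 2)) ^ 2)
      + (ν * (ν + 1)) ^ 2 * (4 / 3 - (2 * Real.tanh R - 2 / 3 * Real.tanh R ^ 3)) := by
  have ct := tanh_cont'
  unfold Jf
  rw [← int_sech4 R hR, mul_sub, ← intervalIntegral.integral_const_mul, add_sub, add_comm _ (_ * (4 / 3)),
    ← add_sub, ← intervalIntegral.integral_sub (ii hR (by fun_prop)) (ii hR (by fun_prop)), add_comm]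
  congr 1
  · ring
  · congr 1; ext x; ring

lemma Jf_ge {R : ℝ} (hR : 0 < R) {W : ℝ → ℝ} (hW : Continuous W) (ν : ℝ) :
    (∫ x in (-R)..R, (W x - (ν * (ν + 1)) * (1 - Real.tanh x ^ 2)) ^ 2) ≤ Jf R ν W := by
  rw [Jf_eq hR hW]
  have hT := tanh_sq_lt' R
  have hT0 := tanh_pos' hR
  have hT1 : Real.tanh R < 1 := by nlinarith
  have : 0 ≤ 4 / 3 - (2 * Real.tanh R - 2 / 3 * Real.tanh R ^ 3) := by
    nlinarith [mul_nonneg (sq_nonneg (1 - Real.tanh R)) (by linarith : 0 ≤ 2 + Real.tanh R)]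
  have := mul_nonneg (sq_nonneg (ν * (ν + 1))) this
  linarith

lemma Jf_nonneg {R : ℝ} (hR : 0 < R) {W : ℝ → ℝ} (hW : Continuous W) (ν : ℝ) : 0 ≤ Jf R ν W :=
  le_trans (intervalIntegral.integral_nonneg (by linarith) (fun y _ => sq_nonneg _)) (Jf_ge hR hW ν)

lemma comW_cont {W : ℝ → ℝ} (hW : Continuous W) {L : ℝ} {F : ℝ → ℝ}
    (hFc : Continuous F) : Continuous (comW W L F) := by
  unfold comW; fun_prop

lemma cube_mono {a b c : ℝ} (h : a ≤ b) : (a - c) ^ 3 ≤ (b - c) ^ 3 :=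
  (Odd.strictMono_pow (by decide : Odd 3)).monotone (by linarith)

theorem LT_free {R : ℝ} (hR : 0 < R) (N : ℕ) : ∀ {W : ℝ → ℝ} (_ : Continuous W) (l : ℕ → ℝ)
    (_ : ∀ k < N, 0 < l k ∧ Tst R W (k + 1) (l k)),
    ∑ k ∈ Finset.range N, 16 / 3 * l k ^ 3 ≤ Jf R 0 W := by
  induction N with
  | zero => intro W hW l _; simpa using Jf_nonneg hR hW 0
  | succ N ih =>
    intro W hW l h
    obtain ⟨h0, hT0⟩ := h 0 (by omega)
    obtain ⟨L, F, hL, hFc, hF, e1, e2⟩ := hT0.ground hR hW h0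
    have hc := comW_cont (L := L) hW hFc
    have := ih hc (fun k => l (k + 1)) (fun k hk => by
      obtain ⟨a, b⟩ := h (k + 1) (by omega)
      exact ⟨a, b.commute hR hW hFc hF a (b.le hR hW hF (by linarith))⟩)
    have hs := Jf_step hR hW hFc hF e1 e2 (le_refl 0)
    have e : Jf R (0 - 1) (comW W L F) = Jf R 0 (comW W L F) := by
      unfold Jf; simp
    have hm := cube_mono (c := 0) hL
    rw [Finset.sum_range_succ']
    rw [e] at hs
    simp only [sub_zero] at hm hs
    linarith

theorem LT_pt {R : ℝ} (hR : 0 < R) (N : ℕ) : ∀ {W : ℝ → ℝ} (_ : Continuous W) (l : ℕ → ℝ)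
    (ν : ℝ) (_ : 0 < ν)
    (_ : ∀ k < N, 0 < l k ∧ Tst R W (k + 1) (l k)),
    ∑ k ∈ Finset.range N, 16 / 3 * (if k < Nat.ceil ν then (l k - (ν - k)) ^ 3 else l k ^ 3)
      ≤ Jf R ν W := by
  induction N with
  | zero => intro W hW l ν _ _; simpa using Jf_nonneg hR hW ν
  | succ N ih =>
    intro W hW l ν hν h
    obtain ⟨h0, hT0⟩ := h 0 (by omega)
    obtain ⟨L, F, hL, hFc, hF, e1, e2⟩ := hT0.ground hR hW h0
    have hc := comW_cont (L := L) hW hFc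
    have hrest : ∀ k < N, 0 < l (k + 1) ∧ Tst R (comW W L F) (k + 1) (l (k + 1)) := fun k hk => by
      obtain ⟨a, b⟩ := h (k + 1) (by omega)
      exact ⟨a, b.commute hR hW hFc hF a (b.le hR hW hF (by linarith))⟩
    have hs := Jf_step hR hW hFc hF e1 e2 hν.le
    have hm := cube_mono (c := ν) hL
    rw [Finset.sum_range_succ', if_pos (Nat.ceil_pos.2 hν)]
    suffices hsuf : ∑ k ∈ Finset.range N, 16 / 3 * (if k + 1 < Nat.ceil ν then
        (l (k + 1) - (ν - ((k + 1 : ℕ) : ℝ))) ^ 3 else l (k + 1) ^ 3) ≤ Jf R (ν - 1) (comW W L F) by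
      simp only [Nat.cast_zero, sub_zero]
      linarith
    by_cases h1 : ν ≤ 1
    · have hceil : Nat.ceil ν ≤ 1 := Nat.ceil_le.2 (by simpa using h1)
      have hc' : Continuous (fun x => max (comW W L F x) 0) := hc.max continuous_const
      have := LT_free hR N hc' (fun k => l (k + 1)) (fun k hk => ⟨(hrest k hk).1,
        (hrest k hk).2.mono hR hc hc' (fun x => le_max_left _ _)⟩)
      calc _ = ∑ k ∈ Finset.range N, 16 / 3 * l (k + 1) ^ 3 := by
            refine Finset.sum_congr rfl fun k _ => ?_
            rw [if_neg (by omega)]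
        _ ≤ _ := this
        _ ≤ ∫ x in (-R)..R, (comW W L F x - ((ν - 1) * (ν - 1 + 1)) * (1 - Real.tanh x ^ 2)) ^ 2 := by
            unfold Jf
            have ct := tanh_cont'
            simp only [zero_mul, mul_zero, sub_zero]
            rw [zero_pow (by norm_num), mul_zero, add_zero]
            refine intervalIntegral.integral_mono (by linarith) (ii hR (by fun_prop)) (ii hR (by fun_prop)) ?_
            intro x
            have h3 : 0 ≤ ((1 - ν) * ν) * (1 - Real.tanh x ^ 2) :=
              mul_nonneg (mul_nonneg (by linarith) hν.le) (by linarith [tanh_sq_lt' x])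
            refine pow_le_pow_left₀ (le_max_right _ _) ?_ 2 |>.trans (le_of_eq (sq_abs _))
            refine max_le ?_ (abs_nonneg _)
            refine le_trans ?_ (le_abs_self _)
            nlinarith
        _ ≤ _ := Jf_ge hR hc (ν - 1)
    · push Not at h1
      have := ih hc (fun k => l (k + 1)) (ν - 1) (by linarith) hrest
      refine le_trans (le_of_eq ?_) this
      refine Finset.sum_congr rfl fun k _ => ?_
      have hceil : Nat.ceil (ν - 1) = Nat.ceil ν - 1 := by
        have := Nat.ceil_sub_one ν
        exact this
      have : (k + 1 < Nat.ceil ν) ↔ (k < Nat.ceil (ν - 1)) := by rw [hceil]; omega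
      simp only [this]
      push_cast
      congr 2
      ring


/-- `f` is `C¹` and `f'` is absolutely continuous with a.e. derivative `f2` -/
def SD (f f2 : ℝ → ℝ) : Prop := ContDiff ℝ 1 f ∧ ∀ a b : ℝ, IntervalIntegrable f2 volume a b ∧
      ∫ x in a..b, f2 x = deriv f b - deriv f a

lemma SD.cont {f f2 : ℝ → ℝ} (h : SD f f2) : Continuous f := h.1.continuous
lemma SD.dcont {f f2 : ℝ → ℝ} (h : SD f f2) : Continuous (deriv f) := h.1.continuous_deriv le_rfl
lemma SD.hasDeriv {f f2 : ℝ → ℝ} (h : SD f f2) (x : ℝ) : HasDerivAt f (deriv f x) x :=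
  (h.1.differentiable one_ne_zero x).hasDerivAt

lemma ibp {R : ℝ} {f f2 u : ℝ → ℝ} (hf : SD f f2) (hu : ContDiff ℝ 1 u)
    (u1 : u (-R) = 0) (u2 : u R = 0) :
    ∫ x in (-R)..R, u x * f2 x = -∫ x in (-R)..R, deriv u x * deriv f x := by
  have hI := (hf.2 (-R) R).1
  have hAC := hI.absolutelyContinuousOnInterval_intervalIntegral (c := -R) (by simp)
  have hAu : AbsolutelyContinuousOnInterval u (-R) R :=
    hu.contDiffOn.absolutelyContinuousOnInterval
  have hmain := hAu.integral_mul_deriv_eq_deriv_mul hAC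
  have hae := hI.ae_hasDerivAt_integral
  have e1 : ∫ x in (-R)..R, u x * f2 x
      = ∫ x in (-R)..R, u x * deriv (fun x => ∫ t in (-R)..x, f2 t) x := by
    apply intervalIntegral.integral_congr_ae
    filter_upwards [hae] with x hx hx2
    rw [(hx (uIoc_subset_uIcc hx2) (-R) (by simp)).deriv]
  have hc := hf.dcont
  have hcu := hu.continuous_deriv le_rfl
  have hu0 : ∫ x in (-R)..R, deriv u x = 0 := by
    rw [intervalIntegral.integral_deriv_eq_sub (fun x _ => hu.differentiable one_ne_zero x)
      (hcu.intervalIntegrable _ _), u1, u2, sub_zero]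
  rw [e1, hmain, u1, u2]
  simp only [(hf.2 (-R) _).2, mul_sub]
  have j1 : IntervalIntegrable (fun x => deriv u x * deriv f x) volume (-R) R :=
    (hcu.mul hc).intervalIntegrable _ _
  have j2 : IntervalIntegrable (fun x => deriv u x * deriv f (-R)) volume (-R) R :=
    (hcu.mul continuous_const).intervalIntegrable _ _
  rw [intervalIntegral.integral_sub j1 j2, intervalIntegral.integral_mul_const, hu0]
  simp

lemma cutoff_exists : ∃ D : ℝ, 0 < D ∧ ∃ χ : ℕ → ℝ → ℝ, ∀ n : ℕ, Adm (2 * ((n : ℝ) + 1)) (χ n) ∧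
    (∀ x, 0 ≤ χ n x ∧ χ n x ≤ 1) ∧ (∀ x, |deriv (χ n) x| ≤ D / ((n : ℝ) + 1)) ∧
    (∀ x, |x| ≤ (n : ℝ) + 1 → χ n x = 1) := by
  let b : ContDiffBump (0 : ℝ) := ⟨1, 2, one_pos, one_lt_two⟩
  have hb1 : ContDiff ℝ 1 (b : ℝ → ℝ) := b.contDiff
  have hcd : Continuous (deriv (b : ℝ → ℝ)) := hb1.continuous_deriv le_rfl
  have hcs : HasCompactSupport (deriv (b : ℝ → ℝ)) := b.hasCompactSupport.deriv
  obtain ⟨D, hD⟩ := hcd.bounded_above_of_compact_support hcs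
  refine ⟨|D| + 1, by positivity, fun n x => b (x * ((n : ℝ) + 1)⁻¹), fun n => ?_⟩
  have hn : (0 : ℝ) < (n : ℝ) + 1 := by positivity
  refine ⟨⟨?_, ?_⟩, ?_, ?_, ?_⟩
  · exact hb1.comp (contDiff_id.mul contDiff_const)
  · intro x hx
    apply b.zero_of_le_dist
    show (2 : ℝ) ≤ _
    rw [Real.dist_eq, sub_zero, abs_mul, abs_of_pos (inv_pos.2 hn), ← div_eq_mul_inv, le_div_iff₀ hn]
    by_contra hcon
    push Not at hcon
    exact hx (abs_lt.1 hcon)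
  · intro x
    exact ⟨b.nonneg, b.le_one⟩
  · intro x
    have h1 : HasDerivAt (fun x : ℝ => b (x * ((n : ℝ) + 1)⁻¹))
        (deriv (b : ℝ → ℝ) (x * ((n : ℝ) + 1)⁻¹) * ((n : ℝ) + 1)⁻¹) x := by
      have h2 : HasDerivAt (fun x : ℝ => x * ((n : ℝ) + 1)⁻¹) (((n : ℝ) + 1)⁻¹) x := by
        simpa using (hasDerivAt_id x).mul_const (((n : ℝ) + 1)⁻¹)
      have h3 : HasDerivAt (b : ℝ → ℝ) (deriv (b : ℝ → ℝ) (x * ((n : ℝ) + 1)⁻¹)) (x * ((n : ℝ) + 1)⁻¹) :=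
        (hb1.differentiable one_ne_zero _).hasDerivAt
      exact HasDerivAt.comp (h₂ := (b : ℝ → ℝ)) x h3 h2
    rw [h1.deriv, abs_mul, abs_of_pos (inv_pos.2 hn), ← div_eq_mul_inv]
    gcongr
    exact (hD _).trans ((le_abs_self D).trans (by linarith))
  · intro x hx
    apply b.one_of_mem_closedBall
    rw [Metric.mem_closedBall]
    show _ ≤ (1 : ℝ)
    rw [Real.dist_eq, sub_zero, abs_mul, abs_of_pos (inv_pos.2 hn), ← div_eq_mul_inv, div_le_one hn]
    exact hx

lemma adm_mul {R : ℝ} {χ f : ℝ → ℝ} (hχ : Adm R χ) (hf : ContDiff ℝ 1 f) :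
    Adm R (fun x => χ x * f x) :=
  ⟨hχ.1.mul hf, fun x hx => by simp [hχ.2 x hx]⟩

lemma energy {R : ℝ} (hR : 0 < R) {χ f f2 W U e : ℝ → ℝ} (hχ : Adm R χ) (hf : SD f f2)
    (hae : ∀ᵐ x : ℝ, -f2 x - W x * f x = e x) (hWU : ∀ x, W x ≤ U x)
    (hU : IntervalIntegrable U volume (-R) R) (he : Continuous e) :
    ∫ x in (-R)..R, (deriv (fun x => χ x * f x) x) ^ 2
      ≤ ∫ x in (-R)..R, (deriv χ x ^ 2 * f x ^ 2 + U x * (χ x ^ 2 * f x ^ 2) + χ x ^ 2 * f x * e x) := by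
  have c1 := hχ.cont
  have c2 := hχ.dcont
  have c3 := hf.cont
  have c4 := hf.dcont
  have hle : -R ≤ R := by linarith
  have hd : ∀ x, deriv (fun x => χ x * f x) x = deriv χ x * f x + χ x * deriv f x :=
    fun x => ((hχ.hasDeriv x).mul (hf.hasDeriv x)).deriv
  have hu : ContDiff ℝ 1 (fun x => χ x ^ 2 * f x) := (hχ.1.pow 2).mul hf.1
  have hud : ∀ x, deriv (fun x => χ x ^ 2 * f x) x
      = 2 * χ x * deriv χ x * f x + χ x ^ 2 * deriv f x := by
    intro x
    refine HasDerivAt.deriv (f := fun x => χ x ^ 2 * f x)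
      ((((hχ.hasDeriv x).pow 2).mul (hf.hasDeriv x)).congr_deriv ?_)
    simp
  have hI := ibp (R := R) hf hu (by simp [hχ.left]) (by simp [hχ.right])
  have hi2 : IntervalIntegrable (fun x => χ x ^ 2 * f x * f2 x) volume (-R) R :=
    (hf.2 (-R) R).1.continuousOn_mul (by fun_prop)
  have e1 : ∫ x in (-R)..R, (deriv (fun x => χ x * f x) x) ^ 2
      = ∫ x in (-R)..R, (deriv χ x ^ 2 * f x ^ 2 - χ x ^ 2 * f x * f2 x) := by
    rw [intervalIntegral.integral_sub (ii hR (by fun_prop)) hi2, hI, sub_neg_eq_add]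
    simp only [hud]
    rw [← intervalIntegral.integral_add (ii hR (by fun_prop)) (ii hR (by fun_prop))]
    congr 1; ext x; rw [hd]; ring
  rw [e1]
  apply intervalIntegral.integral_mono_ae hle
  · exact (ii hR (by fun_prop)).sub hi2
  · refine ((ii hR (by fun_prop)).add ?_).add (ii hR (by fun_prop))
    exact hU.mul_continuousOn (by fun_prop)
  · filter_upwards [hae] with x hx
    have h1 : f2 x = - W x * f x - e x := by linarith
    rw [h1]
    have h2 := mul_le_mul_of_nonneg_right (hWU x) (by positivity : 0 ≤ χ x ^ 2 * f x ^ 2)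
    nlinarith

lemma sup_bound {R : ℝ} (hR : 0 < R) {h : ℝ → ℝ} (hh : Adm R h) (x : ℝ) :
    h x ^ 2 ≤ nf R h + ∫ x in (-R)..R, deriv h x ^ 2 := by
  have c1 := hh.cont
  have c2 := hh.dcont
  unfold nf
  rw [← intervalIntegral.integral_add (ii hR (by fun_prop)) (ii hR (by fun_prop))]
  by_cases hx : x ∈ Ioo (-R) R
  · have h1 : ∫ y in (-R)..x, (2 * h y * deriv h y) = h x ^ 2 := by
      rw [ftc_Icc (f := fun x => h x ^ 2) hx.1.le]
      · simp [hh.left]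
      · intro y _
        have := ((hh.hasDeriv y).pow 2).hasDerivWithinAt (s := Icc (-R) x)
        refine this.congr_deriv ?_
        simp
      · fun_prop
    rw [← h1]
    have hc : Continuous fun y => h y ^ 2 + deriv h y ^ 2 := by fun_prop
    have hc' : Continuous fun y => 2 * h y * deriv h y := by fun_prop
    calc _ ≤ ∫ y in (-R)..x, (h y ^ 2 + deriv h y ^ 2) := by
          refine intervalIntegral.integral_mono hx.1.le (hc'.intervalIntegrable _ _)
            (hc.intervalIntegrable _ _) ?_
          intro y
          simp only
          nlinarith [sq_nonneg (h y - deriv h y)]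
      _ ≤ _ := by
          refine intervalIntegral.integral_mono_interval le_rfl hx.1.le hx.2.le ?_
            (hc.intervalIntegrable _ _)
          exact Filter.Eventually.of_forall fun y => by positivity
  · rw [hh.2 x hx]
    have : 0 ≤ ∫ x in (-R)..R, (h x ^ 2 + deriv h x ^ 2) :=
      intervalIntegral.integral_nonneg (by linarith) (fun y _ => by positivity)
    simpa using this

lemma int_le {R : ℝ} (hR : 0 < R) {f : ℝ → ℝ} (hf : Integrable f) (h0 : ∀ x, 0 ≤ f x) :
    ∫ x in (-R)..R, f x ≤ ∫ x, f x := by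
  rw [intervalIntegral.integral_of_le (by linarith)]
  exact setIntegral_le_integral hf (Filter.Eventually.of_forall h0)

lemma nf_cut_le {R : ℝ} (hR : 0 < R) {χ ψ : ℝ → ℝ} (hχ : Adm R χ) (hχ1 : ∀ x, 0 ≤ χ x ∧ χ x ≤ 1)
    (hψ : Continuous ψ) (hP : Integrable (fun x => ψ x ^ 2)) :
    nf R (fun x => χ x * ψ x) ≤ ∫ x, ψ x ^ 2 := by
  have c1 := hχ.cont
  refine le_trans ?_ (int_le hR hP (fun x => sq_nonneg _))
  refine intervalIntegral.integral_mono (by linarith) (ii hR (by fun_prop)) (ii hR (by fun_prop)) ?_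
  intro x
  simp only
  rw [mul_pow]
  have := hχ1 x
  have h2 : χ x ^ 2 ≤ 1 := by nlinarith
  nlinarith [mul_nonneg (sub_nonneg.2 h2) (sq_nonneg (ψ x))]

lemma cacc {R : ℝ} (hR : 0 < R) {χ ψ ψ2 W W0 Y : ℝ → ℝ} {E D c0 : ℝ} (hχ : Adm R χ)
    (hχ1 : ∀ x, 0 ≤ χ x ∧ χ x ≤ 1) (hχ2 : ∀ x, |deriv χ x| ≤ D) (hψ : SD ψ ψ2)
    (hP : Integrable (fun x => ψ x ^ 2)) (hE : E < 0)
    (hae : ∀ᵐ x : ℝ, -ψ2 x - W x * ψ x = E * ψ x)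
    (hWU : ∀ x, W x ≤ W0 x + Y x) (hW0 : Continuous W0) (hW1 : ∀ x, W0 x ≤ c0)
    (hYi : ∀ a b, IntervalIntegrable Y volume a b) (hY : Integrable (fun x => Y x ^ 2)) :
    ∫ x in (-R)..R, (deriv (fun x => χ x * ψ x) x) ^ 2
      ≤ (2 * D ^ 2 + 2 * |c0| + 2 + ∫ x, Y x ^ 2) * ∫ x, ψ x ^ 2 := by
  have c1 := hχ.cont
  have c2 := hχ.dcont
  have c3 := hψ.cont
  have c4 := hψ.dcont
  have hh := adm_mul hχ hψ.1
  have c5 := hh.cont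
  have c6 := hh.dcont
  set Q := ∫ x, Y x ^ 2 with hQ
  set P := ∫ x, ψ x ^ 2 with hPdef
  have hQ0 : 0 ≤ Q := integral_nonneg (fun x => sq_nonneg _)
  have hP0 : 0 ≤ P := integral_nonneg (fun x => sq_nonneg _)
  have hen := energy hR (e := fun x => E * ψ x) hχ hψ hae hWU
    ((ii hR hW0.continuousOn).add (hYi _ _)) (by fun_prop)
  set H := ∫ x in (-R)..R, (deriv (fun x => χ x * ψ x) x) ^ 2 with hH
  have hn := nf_cut_le hR hχ hχ1 c3 hP
  have hn0 := nf_nonneg hR (fun x => χ x * ψ x)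
  set n := nf R (fun x => χ x * ψ x) with hnd
  have hsup := sup_bound hR hh
  have hH0 : 0 ≤ H := intervalIntegral.integral_nonneg (by linarith) (fun y _ => sq_nonneg _)
  have hYR : ∫ x in (-R)..R, Y x ^ 2 ≤ Q := int_le hR hY (fun x => sq_nonneg _)
  have hPR : ∫ x in (-R)..R, ψ x ^ 2 ≤ P := int_le hR hP (fun x => sq_nonneg _)
  have hYii : IntervalIntegrable (fun x => Y x ^ 2) volume (-R) R := hY.intervalIntegrable
  have hbound : ∫ x in (-R)..R, (deriv χ x ^ 2 * ψ x ^ 2 + (W0 x + Y x) * (χ x ^ 2 * ψ x ^ 2)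
      + χ x ^ 2 * ψ x * (E * ψ x)) ≤ ∫ x in (-R)..R, (D ^ 2 * ψ x ^ 2 +
        (|c0| + (Q + 1) / 2) * (χ x * ψ x) ^ 2 + ((n + H) / (2 * (Q + 1))) * Y x ^ 2) := by
    refine intervalIntegral.integral_mono (by linarith) ?_ ?_ ?_
    · refine ((ii hR (by fun_prop)).add ?_).add (ii hR (by fun_prop))
      exact ((ii hR hW0.continuousOn).add (hYi _ _)).mul_continuousOn (by fun_prop)
    · exact (ii hR (by fun_prop)).add (hYii.const_mul _)
    · intro x
      simp only
      have h1 : deriv χ x ^ 2 ≤ D ^ 2 := sq_le_sq' (by linarith [(abs_le.1 (hχ2 x)).1]) (abs_le.1 (hχ2 x)).2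
      have h2 := mul_le_mul_of_nonneg_right h1 (sq_nonneg (ψ x))
      have h3 := mul_le_mul_of_nonneg_right ((hW1 x).trans (le_abs_self c0)) (sq_nonneg (χ x * ψ x))
      have h4 : E * (χ x * ψ x) ^ 2 ≤ 0 := mul_nonpos_of_nonpos_of_nonneg hE.le (sq_nonneg _)
      have h5 : Y x * (χ x * ψ x) ^ 2 ≤ (Q + 1) / 2 * (χ x * ψ x) ^ 2
          + ((n + H) / (2 * (Q + 1))) * Y x ^ 2 := by
        have hs := hsup x
        have hq1 : 0 < Q + 1 := by linarith
        have h6 : ((χ x * ψ x) ^ 2 / (2 * (Q + 1))) * Y x ^ 2 ≤ ((n + H) / (2 * (Q + 1))) * Y x ^ 2 := by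
          gcongr
        have h7 : 0 ≤ (χ x * ψ x) ^ 2 / (2 * (Q + 1)) * (Y x - (Q + 1)) ^ 2 := by positivity
        have h8 : (χ x * ψ x) ^ 2 / (2 * (Q + 1)) * (Y x - (Q + 1)) ^ 2
          = (χ x * ψ x) ^ 2 / (2 * (Q + 1)) * Y x ^ 2 - Y x * (χ x * ψ x) ^ 2
            + (Q + 1) / 2 * (χ x * ψ x) ^ 2 := by
          field_simp; ring
        linarith
      nlinarith
  have heq : ∫ x in (-R)..R, (D ^ 2 * ψ x ^ 2 +
        (|c0| + (Q + 1) / 2) * (χ x * ψ x) ^ 2 + ((n + H) / (2 * (Q + 1))) * Y x ^ 2)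
      = D ^ 2 * (∫ x in (-R)..R, ψ x ^ 2) + (|c0| + (Q + 1) / 2) * n
        + ((n + H) / (2 * (Q + 1))) * ∫ x in (-R)..R, Y x ^ 2 := by
    rw [intervalIntegral.integral_add (ii hR (by fun_prop)) (hYii.const_mul _),
      intervalIntegral.integral_add (ii hR (by fun_prop)) (ii hR (by fun_prop)),
      intervalIntegral.integral_const_mul, intervalIntegral.integral_const_mul,
      intervalIntegral.integral_const_mul]
    rfl
  have h1 : D ^ 2 * (∫ x in (-R)..R, ψ x ^ 2) ≤ D ^ 2 * P := by gcongr
  have h2 : (|c0| + (Q + 1) / 2) * n ≤ (|c0| + (Q + 1) / 2) * P := by gcongr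
  have h3 : ((n + H) / (2 * (Q + 1))) * ∫ x in (-R)..R, Y x ^ 2 ≤ (n + H) / 2 := by
    calc _ ≤ ((n + H) / (2 * (Q + 1))) * (Q + 1) := by
          gcongr; linarith
      _ = _ := by field_simp
  nlinarith

lemma orth_bound {R : ℝ} (hR : 0 < R) {χ f f2 g g2 W : ℝ → ℝ} {E E' D d C C' : ℝ} (hχ : Adm R χ)
    (hχ1 : ∀ x, 0 ≤ χ x ∧ χ x ≤ 1) (hχ2 : ∀ x, |deriv χ x| ≤ d) (hdD : d ≤ D) (hf : SD f f2)
    (hg : SD g g2)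
    (hP : Integrable (fun x => f x ^ 2)) (hP' : Integrable (fun x => g x ^ 2))
    (hae : ∀ᵐ x : ℝ, -f2 x - W x * f x = E * f x)
    (hae' : ∀ᵐ x : ℝ, -g2 x - W x * g x = E' * g x)
    (hC : ∫ x in (-R)..R, (deriv (fun x => χ x * f x) x) ^ 2 ≤ C)
    (hC' : ∫ x in (-R)..R, (deriv (fun x => χ x * g x) x) ^ 2 ≤ C') :
    |(E - E') * ∫ x in (-R)..R, χ x ^ 2 * f x * g x|
      ≤ d * ((1 + 2 * D ^ 2) * ((∫ x, f x ^ 2) + ∫ x, g x ^ 2) + 2 * C + 2 * C') := by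
  have c1 := hχ.cont
  have c2 := hχ.dcont
  have c3 := hf.cont
  have c4 := hf.dcont
  have c5 := hg.cont
  have c6 := hg.dcont
  have c7 := (adm_mul hχ hf.1).dcont
  have c8 := (adm_mul hχ hg.1).dcont
  have hd0 : 0 ≤ d := (abs_nonneg _).trans (hχ2 0)
  have hud : ∀ {k k2 : ℝ → ℝ} (_ : SD k k2) (x : ℝ), deriv (fun x => χ x ^ 2 * k x) x
      = 2 * χ x * deriv χ x * k x + χ x ^ 2 * deriv k x := by
    intro k k2 hk x
    refine HasDerivAt.deriv (f := fun x => χ x ^ 2 * k x)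
      ((((hχ.hasDeriv x).pow 2).mul (hk.hasDeriv x)).congr_deriv ?_)
    simp
  have hd : ∀ {k k2 : ℝ → ℝ} (_ : SD k k2) (x : ℝ), deriv (fun x => χ x * k x) x
      = deriv χ x * k x + χ x * deriv k x := by
    intro k k2 hk x
    exact ((hχ.hasDeriv x).mul (hk.hasDeriv x)).deriv
  have I1 := ibp (R := R) hg ((hχ.1.pow 2).mul hf.1) (by simp [hχ.left]) (by simp [hχ.right])
  have I2 := ibp (R := R) hf ((hχ.1.pow 2).mul hg.1) (by simp [hχ.left]) (by simp [hχ.right])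
  simp only [hud hf] at I1
  simp only [hud hg] at I2
  have hi1 : IntervalIntegrable (fun x => χ x ^ 2 * f x * g2 x) volume (-R) R :=
    (hg.2 (-R) R).1.continuousOn_mul (by fun_prop)
  have hi2 : IntervalIntegrable (fun x => χ x ^ 2 * g x * f2 x) volume (-R) R :=
    (hf.2 (-R) R).1.continuousOn_mul (by fun_prop)
  have e1 : (E - E') * ∫ x in (-R)..R, χ x ^ 2 * f x * g x
      = (∫ x in (-R)..R, χ x ^ 2 * f x * g2 x) - ∫ x in (-R)..R, χ x ^ 2 * g x * f2 x := by
    rw [← intervalIntegral.integral_sub hi1 hi2, ← intervalIntegral.integral_const_mul]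
    apply intervalIntegral.integral_congr_ae
    filter_upwards [hae, hae'] with x h1 h2 _
    have h1' : f2 x = - W x * f x - E * f x := by linarith
    have h2' : g2 x = - W x * g x - E' * g x := by linarith
    rw [h1', h2']; ring
  have e2 : (E - E') * ∫ x in (-R)..R, χ x ^ 2 * f x * g x
      = ∫ x in (-R)..R, 2 * χ x * deriv χ x * (g x * deriv f x - f x * deriv g x) := by
    rw [e1, I1, I2, sub_neg_eq_add, neg_add_eq_sub, ← intervalIntegral.integral_sub (ii hR (by fun_prop)) (ii hR (by fun_prop))]
    congr 1; ext x; ring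
  rw [e2]
  have hb : ∫ x in (-R)..R, d * ((1 + 2 * D ^ 2) * (f x ^ 2 + g x ^ 2)
      + 2 * (deriv (fun x => χ x * f x) x) ^ 2 + 2 * (deriv (fun x => χ x * g x) x) ^ 2)
      = d * ((1 + 2 * D ^ 2) * ((∫ x in (-R)..R, f x ^ 2) + ∫ x in (-R)..R, g x ^ 2)
      + 2 * (∫ x in (-R)..R, (deriv (fun x => χ x * f x) x) ^ 2)
      + 2 * ∫ x in (-R)..R, (deriv (fun x => χ x * g x) x) ^ 2) := by
    rw [intervalIntegral.integral_const_mul,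
      intervalIntegral.integral_add (ii hR (by fun_prop)) (ii hR (by fun_prop)),
      intervalIntegral.integral_add (ii hR (by fun_prop)) (ii hR (by fun_prop)),
      intervalIntegral.integral_const_mul, intervalIntegral.integral_const_mul,
      intervalIntegral.integral_const_mul,
      intervalIntegral.integral_add (ii hR (by fun_prop)) (ii hR (by fun_prop))]
  have hlast : ∫ x in (-R)..R, d * ((1 + 2 * D ^ 2) * (f x ^ 2 + g x ^ 2)
      + 2 * (deriv (fun x => χ x * f x) x) ^ 2 + 2 * (deriv (fun x => χ x * g x) x) ^ 2)
      ≤ d * ((1 + 2 * D ^ 2) * ((∫ x, f x ^ 2) + ∫ x, g x ^ 2) + 2 * C + 2 * C') := by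
    rw [hb]
    have := int_le hR hP (fun x => sq_nonneg _)
    have := int_le hR hP' (fun x => sq_nonneg _)
    gcongr
  refine le_trans ?_ hlast
  rw [← Real.norm_eq_abs]
  refine intervalIntegral.norm_integral_le_of_norm_le (by linarith) ?_ (ii hR (by fun_prop))
  refine Filter.Eventually.of_forall fun x _ => ?_
  rw [hd hf, hd hg, Real.norm_eq_abs]
  have hx := hχ2 x
  have hχd : deriv χ x ^ 2 ≤ D ^ 2 := by
    rw [← sq_abs]; exact pow_le_pow_left₀ (abs_nonneg _) (hx.trans hdD) 2
  have key : ∀ a b b' : ℝ, 2 * |χ x| * |a| * |b'| ≤ a ^ 2 + (2 * D ^ 2) * b ^ 2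
      + 2 * (deriv χ x * b + χ x * b') ^ 2 := by
    intro a b b'
    have h1 : 2 * |χ x| * |a| * |b'| ≤ a ^ 2 + (χ x * b') ^ 2 := by
      have := two_mul_le_add_sq |a| (|χ x| * |b'|)
      rw [mul_pow, sq_abs, sq_abs, sq_abs] at this
      nlinarith
    have h2 : (χ x * b') ^ 2 ≤ 2 * (deriv χ x * b + χ x * b') ^ 2 + 2 * (deriv χ x * b) ^ 2 := by
      nlinarith [sq_nonneg (χ x * b' + 2 * (deriv χ x * b))]
    have h3 := mul_le_mul_of_nonneg_right hχd (sq_nonneg b)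
    nlinarith
  have k1 := key (g x) (f x) (deriv f x)
  have k2 := key (f x) (g x) (deriv g x)
  calc |2 * χ x * deriv χ x * (g x * deriv f x - f x * deriv g x)|
      = |deriv χ x| * (2 * |χ x| * |g x * deriv f x - f x * deriv g x|) := by
        rw [abs_mul, abs_mul, abs_mul, abs_two]; ring
    _ ≤ d * (2 * |χ x| * |g x * deriv f x - f x * deriv g x|) := by gcongr
    _ ≤ d * (2 * |χ x| * |g x| * |deriv f x| + 2 * |χ x| * |f x| * |deriv g x|) := by
        gcongr
        have := abs_sub (g x * deriv f x) (f x * deriv g x)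
        rw [abs_mul, abs_mul] at this
        calc _ ≤ 2 * |χ x| * (|g x| * |deriv f x| + |f x| * |deriv g x|) := by gcongr
          _ = _ := by ring
    _ ≤ _ := by
        refine mul_le_mul_of_nonneg_left ?_ hd0
        linarith

lemma negdef {ι : Type*} [Fintype ι] (M : ℕ → ι → ι → ℝ) (m : ι → ℝ) (hm : ∀ i, 0 < m i)
    (hoff : ∀ i j, i ≠ j → Tendsto (fun n => M n i j) atTop (𝓝 0))
    (hd : ∀ i, ∀ᶠ n in atTop, M n i i ≤ - m i) :
    ∀ᶠ n in atTop, ∀ c : ι → ℝ, c ≠ 0 → ∑ i, ∑ j, c i * c j * M n i j < 0 := by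
  classical
  obtain ⟨δ, hδ, hδm⟩ : ∃ δ : ℝ, 0 < δ ∧ ∀ i, δ ≤ m i := by
    rcases isEmpty_or_nonempty ι with h | h
    · exact ⟨1, one_pos, fun i => (h.false i).elim⟩
    · obtain ⟨i0, hi0⟩ := Finite.exists_min m
      exact ⟨m i0, hm i0, hi0⟩
  set K : ℝ := (Fintype.card ι : ℝ) with hK
  have hK0 : 0 ≤ K := Nat.cast_nonneg _
  set t : ℝ := δ / (2 * (K + 1)) with ht
  have ht0 : 0 < t := by positivity
  have htK : t * K ≤ δ / 2 := by
    rw [ht, div_mul_eq_mul_div, div_le_div_iff₀ (by positivity) two_pos]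
    nlinarith
  have h1 : ∀ᶠ n in atTop, ∀ i j, i ≠ j → |M n i j| ≤ t := by
    rw [eventually_all]; intro i
    rw [eventually_all]; intro j
    by_cases hij : i = j
    · simp [hij]
    · have := (hoff i j hij).abs
      rw [abs_zero] at this
      filter_upwards [this.eventually (ge_mem_nhds ht0)] with n hn _
      exact hn
  have h2 : ∀ᶠ n in atTop, ∀ i, M n i i ≤ - m i := eventually_all.2 hd
  filter_upwards [h1, h2] with n hn1 hn2 c hc
  have hterm : ∀ i j, c i * c j * M n i j ≤ (if i = j then -δ * c i ^ 2 else 0)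
      + t / 2 * (c i ^ 2 + c j ^ 2) := by
    intro i j
    by_cases hij : i = j
    · subst hij
      simp only [if_true]
      have h3 : M n i i ≤ -δ := (hn2 i).trans (by linarith [hδm i])
      have h4 := mul_le_mul_of_nonneg_left h3 (sq_nonneg (c i))
      have h5 : 0 ≤ t / 2 * (c i ^ 2 + c i ^ 2) := by positivity
      nlinarith
    · rw [if_neg hij, zero_add]
      calc c i * c j * M n i j ≤ |c i * c j * M n i j| := le_abs_self _
        _ = |c i| * |c j| * |M n i j| := by rw [abs_mul, abs_mul]
        _ ≤ |c i| * |c j| * t := by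
            have := hn1 i j hij
            gcongr
        _ ≤ t / 2 * (c i ^ 2 + c j ^ 2) := by
            have := two_mul_le_add_sq |c i| |c j|
            rw [sq_abs, sq_abs] at this
            nlinarith
  have hs : 0 < ∑ i, c i ^ 2 := by
    obtain ⟨i, hi⟩ := Function.ne_iff.1 hc
    have : 0 < c i ^ 2 := by
      have : c i ≠ 0 := hi
      positivity
    exact lt_of_lt_of_le this
      (Finset.single_le_sum (f := fun i => c i ^ 2) (fun i _ => sq_nonneg _) (Finset.mem_univ i))
  have hle : ∑ i, ∑ j, c i * c j * M n i j ≤ ∑ i, ∑ j, ((if i = j then -δ * c i ^ 2 else 0)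
      + t / 2 * (c i ^ 2 + c j ^ 2)) :=
    Finset.sum_le_sum fun i _ => Finset.sum_le_sum fun j _ => hterm i j
  have heq : ∑ i, ∑ j, ((if i = j then -δ * c i ^ 2 else 0) + t / 2 * (c i ^ 2 + c j ^ 2))
      = -δ * (∑ i, c i ^ 2) + t * K * ∑ i, c i ^ 2 := by
    simp only [Finset.sum_add_distrib, ← Finset.mul_sum, Finset.sum_ite_eq, Finset.mem_univ, if_true,
      Finset.sum_const, Finset.card_univ, nsmul_eq_mul, ← hK]
    ring
  rw [heq] at hle
  nlinarith

lemma term1 {R : ℝ} (hR : 0 < R) {χ f g : ℝ → ℝ} {d : ℝ} (hχ : Adm R χ)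
    (hχ2 : ∀ x, |deriv χ x| ≤ d) (hf : Continuous f) (hg : Continuous g)
    (hP : Integrable (fun x => f x ^ 2)) (hP' : Integrable (fun x => g x ^ 2)) :
    |∫ x in (-R)..R, deriv χ x ^ 2 * (f x * g x)| ≤ d ^ 2 * ((∫ x, f x ^ 2) + ∫ x, g x ^ 2) := by
  have c2 := hχ.dcont
  have hlast : ∫ x in (-R)..R, d ^ 2 * (f x ^ 2 + g x ^ 2)
      ≤ d ^ 2 * ((∫ x, f x ^ 2) + ∫ x, g x ^ 2) := by
    rw [intervalIntegral.integral_const_mul,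
      intervalIntegral.integral_add (ii hR (by fun_prop)) (ii hR (by fun_prop))]
    have := int_le hR hP (fun x => sq_nonneg _)
    have := int_le hR hP' (fun x => sq_nonneg _)
    gcongr
  refine le_trans ?_ hlast
  rw [← Real.norm_eq_abs]
  refine intervalIntegral.norm_integral_le_of_norm_le (by linarith) ?_ (ii hR (by fun_prop))
  refine Filter.Eventually.of_forall fun x _ => ?_
  rw [Real.norm_eq_abs, abs_mul, abs_of_nonneg (sq_nonneg (deriv χ x))]
  have h1 : deriv χ x ^ 2 ≤ d ^ 2 := by
    rw [← sq_abs]; exact pow_le_pow_left₀ (abs_nonneg _) (hχ2 x) 2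
  have h2 : |f x * g x| ≤ f x ^ 2 + g x ^ 2 := by
    rw [abs_le]
    constructor <;> nlinarith [sq_nonneg (f x + g x), sq_nonneg (f x - g x), sq_nonneg (f x), sq_nonneg (g x)]
  gcongr

lemma term2 {R : ℝ} (hR : 0 < R) {χ f g Z : ℝ → ℝ} {B t : ℝ} (hχ : Adm R χ)
    (hχ1 : ∀ x, 0 ≤ χ x ∧ χ x ≤ 1) (hg : Continuous g)
    (hB : ∀ x, f x ^ 2 ≤ B) (ht : 0 < t) (hZ : Integrable (fun x => Z x ^ 2))
    (hP' : Integrable (fun x => g x ^ 2)) :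
    |∫ x in (-R)..R, χ x ^ 2 * Z x * (f x * g x)|
      ≤ t * B * (∫ x, Z x ^ 2) + (∫ x, g x ^ 2) / t := by
  have c2 := hχ.dcont
  have hB0 : 0 ≤ B := (sq_nonneg _).trans (hB 0)
  have hZi : IntervalIntegrable (fun x => Z x ^ 2) volume (-R) R := hZ.intervalIntegrable
  have hgi : IntervalIntegrable (fun x => g x ^ 2) volume (-R) R := hP'.intervalIntegrable
  have hlast : ∫ x in (-R)..R, (t * B * Z x ^ 2 + g x ^ 2 / t)
      ≤ t * B * (∫ x, Z x ^ 2) + (∫ x, g x ^ 2) / t := by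
    rw [intervalIntegral.integral_add (hZi.const_mul _) (hgi.div_const _),
      intervalIntegral.integral_const_mul, intervalIntegral.integral_div]
    have := int_le hR hZ (fun x => sq_nonneg _)
    have := int_le hR hP' (fun x => sq_nonneg _)
    gcongr
  refine le_trans ?_ hlast
  rw [← Real.norm_eq_abs]
  refine intervalIntegral.norm_integral_le_of_norm_le (by linarith) ?_
    ((hZi.const_mul _).add (hgi.div_const _))
  refine Filter.Eventually.of_forall fun x _ => ?_
  have h1 : χ x ^ 2 ≤ 1 := by nlinarith [hχ1 x]
  have h2 : |Z x * (f x * g x)| ≤ t * B * Z x ^ 2 + g x ^ 2 / t := by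
    have h3 : |Z x * (f x * g x)| ≤ t * (Z x * f x) ^ 2 + g x ^ 2 / t := by
      have e1 : 0 ≤ (t * (Z x * f x) + g x) ^ 2 / t := by positivity
      have e2 : 0 ≤ (t * (Z x * f x) - g x) ^ 2 / t := by positivity
      have e3 : (t * (Z x * f x) + g x) ^ 2 / t
        = t * (Z x * f x) ^ 2 + g x ^ 2 / t + 2 * (Z x * (f x * g x)) := by field_simp; ring
      have e4 : (t * (Z x * f x) - g x) ^ 2 / t
        = t * (Z x * f x) ^ 2 + g x ^ 2 / t - 2 * (Z x * (f x * g x)) := by field_simp; ring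
      have e5 : 0 ≤ t * (Z x * f x) ^ 2 + g x ^ 2 / t := by positivity
      rw [abs_le]; constructor <;> linarith
    have h4 : t * (Z x * f x) ^ 2 ≤ t * B * Z x ^ 2 := by
      have := mul_le_mul_of_nonneg_left (hB x) (by positivity : 0 ≤ t * Z x ^ 2)
      nlinarith
    linarith
  rw [Real.norm_eq_abs, mul_assoc, abs_mul, abs_of_nonneg (sq_nonneg (χ x))]
  calc _ ≤ 1 * |Z x * (f x * g x)| := by gcongr
    _ ≤ _ := by rw [one_mul]; exact h2

lemma SD.sum {ι : Type*} [Fintype ι] {ψ ψ2 : ι → ℝ → ℝ} (h : ∀ i, SD (ψ i) (ψ2 i)) (c : ι → ℝ) :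
    SD (fun x => ∑ i, c i * ψ i x) (fun x => ∑ i, c i * ψ2 i x) := by
  have hd : ∀ x, deriv (fun x => ∑ i, c i * ψ i x) x = ∑ i, c i * deriv (ψ i) x := by
    intro x
    refine HasDerivAt.deriv ?_
    exact HasDerivAt.fun_sum fun i _ => ((h i).hasDeriv x).const_mul (c i)
  refine ⟨ContDiff.sum fun i _ => contDiff_const.mul (h i).1, fun a b => ⟨?_, ?_⟩⟩
  · have := IntervalIntegrable.sum (μ := volume) (a := a) (b := b) Finset.univ
      (f := fun i x => c i * ψ2 i x) (fun i _ => ((h i).2 a b).1.const_mul (c i))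
    refine this.congr ?_
    intro x _
    simp
  · rw [intervalIntegral.integral_finsetSum (fun i _ => ((h i).2 a b).1.const_mul (c i)), hd, hd,
      ← Finset.sum_sub_distrib]
    refine Finset.sum_congr rfl fun i _ => ?_
    rw [intervalIntegral.integral_const_mul, ((h i).2 a b).2]; ring

lemma approx {Y : ℝ → ℝ} (hY : MemLp Y 2 (volume : Measure ℝ)) : ∃ Yn : ℕ → ℝ → ℝ, ∀ n : ℕ,
    Continuous (Yn n) ∧ Integrable (fun x => Yn n x ^ 2) ∧ Integrable (fun x => (Y x - Yn n x) ^ 2) ∧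
    ∫ x, (Y x - Yn n x) ^ 2 ≤ 1 / ((n : ℝ) + 1) ^ 2 := by
  have key : ∀ n : ℕ, ∃ g : ℝ → ℝ, Continuous g ∧ Integrable (fun x => g x ^ 2) ∧
      Integrable (fun x => (Y x - g x) ^ 2) ∧ ∫ x, (Y x - g x) ^ 2 ≤ 1 / ((n : ℝ) + 1) ^ 2 := by
    intro n
    have h2 : MemLp Y (ENNReal.ofReal 2) (volume : Measure ℝ) := by simpa using hY
    obtain ⟨g, _, h3, h4, h5⟩ := h2.exists_hasCompactSupport_integral_rpow_sub_le (by norm_num)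
      (ε := 1 / ((n : ℝ) + 1) ^ 2) (by positivity)
    have h5' : MemLp g 2 (volume : Measure ℝ) := by simpa using h5
    refine ⟨g, h4, h5'.integrable_sq, (hY.sub h5').integrable_sq, ?_⟩
    simpa using h3
  choose Yn h using key
  exact ⟨Yn, h⟩

/-- eigenfunction data -/
def EigD (W : ℝ → ℝ) (E : ℝ) (ψ ψ2 : ℝ → ℝ) : Prop :=
  SD ψ ψ2 ∧ Integrable (fun x => ψ x ^ 2) ∧ E < 0 ∧ ∀ᵐ x : ℝ, -ψ2 x - W x * ψ x = E * ψ x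

/-- cutoff data -/
def CutD (D : ℝ) (χ : ℕ → ℝ → ℝ) : Prop := ∀ n : ℕ, Adm (2 * ((n : ℝ) + 1)) (χ n) ∧
    (∀ x, 0 ≤ χ n x ∧ χ n x ≤ 1) ∧ (∀ x, |deriv (χ n) x| ≤ D / ((n : ℝ) + 1)) ∧
    (∀ x, |x| ≤ (n : ℝ) + 1 → χ n x = 1)

/-- matrix entries -/
noncomputable def Mat (χ : ℕ → ℝ → ℝ) (Y : ℝ → ℝ) (Yn : ℕ → ℝ → ℝ) (e E' : ℝ) (f g : ℝ → ℝ) (n : ℕ) : ℝ :=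
  ∫ x in (-(2 * ((n : ℝ) + 1)))..(2 * ((n : ℝ) + 1)),
    (deriv (χ n) x ^ 2 * (f x * g x) + χ n x ^ 2 * (Y x - Yn n x) * (f x * g x)
      + (E' - e) * (χ n x ^ 2 * f x * g x))

lemma CutD.dle {D : ℝ} {χ : ℕ → ℝ → ℝ} (h : CutD D χ) (hD : 0 < D) (n : ℕ) (x : ℝ) :
    |deriv (χ n) x| ≤ D := by
  refine ((h n).2.2.1 x).trans (div_le_self hD.le ?_)
  have : (0 : ℝ) ≤ n := Nat.cast_nonneg _
  linarith

section
variable {W W0 Y : ℝ → ℝ} {Yn : ℕ → ℝ → ℝ} {χ : ℕ → ℝ → ℝ} {D c0 e : ℝ}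

lemma eig_bounds (hD : 0 < D) (hχ : CutD D χ)
    (hWU : ∀ x, W x ≤ W0 x + Y x) (hW0 : Continuous W0) (hW1 : ∀ x, W0 x ≤ c0)
    (hYi : ∀ a b, IntervalIntegrable Y volume a b) (hY : Integrable (fun x => Y x ^ 2))
    {E : ℝ} {ψ ψ2 : ℝ → ℝ} (h : EigD W E ψ ψ2) :
    ∃ C B : ℝ, (∀ n : ℕ, ∫ x in (-(2 * ((n : ℝ) + 1)))..(2 * ((n : ℝ) + 1)),
      (deriv (fun x => χ n x * ψ x) x) ^ 2 ≤ C) ∧ ∀ x, ψ x ^ 2 ≤ B := by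
  obtain ⟨h1, h2, h3, h4⟩ := h
  have hC : ∀ n : ℕ, ∫ x in (-(2 * ((n : ℝ) + 1)))..(2 * ((n : ℝ) + 1)),
      (deriv (fun x => χ n x * ψ x) x) ^ 2
      ≤ (2 * D ^ 2 + 2 * |c0| + 2 + ∫ x, Y x ^ 2) * ∫ x, ψ x ^ 2 := by
    intro n
    exact cacc (by positivity) (hχ n).1 (hχ n).2.1 (hχ.dle hD n) h1 h2 h3 h4 hWU hW0 hW1 hYi hY
  refine ⟨_, (∫ x, ψ x ^ 2) + (2 * D ^ 2 + 2 * |c0| + 2 + ∫ x, Y x ^ 2) * ∫ x, ψ x ^ 2, hC, ?_⟩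
  intro x
  obtain ⟨n, hn⟩ := exists_nat_ge |x|
  have hR : (0 : ℝ) < 2 * ((n : ℝ) + 1) := by positivity
  have := sup_bound hR (adm_mul (hχ n).1 h1.1) x
  simp only [(hχ n).2.2.2 x (by linarith), one_mul] at this
  have h5 := nf_cut_le hR (hχ n).1 (hχ n).2.1 h1.cont h2
  have := hC n
  linarith

lemma mat_split (hχ : CutD D χ) (hYi : ∀ a b, IntervalIntegrable Y volume a b)
    (hYn : ∀ n, Continuous (Yn n)) {E' : ℝ} {f g : ℝ → ℝ} (hf : Continuous f) (hg : Continuous g)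
    (n : ℕ) : Mat χ Y Yn e E' f g n =
      (∫ x in (-(2 * ((n : ℝ) + 1)))..(2 * ((n : ℝ) + 1)), deriv (χ n) x ^ 2 * (f x * g x)) +
      (∫ x in (-(2 * ((n : ℝ) + 1)))..(2 * ((n : ℝ) + 1)), χ n x ^ 2 * (Y x - Yn n x) * (f x * g x)) +
      (E' - e) * (∫ x in (-(2 * ((n : ℝ) + 1)))..(2 * ((n : ℝ) + 1)), χ n x ^ 2 * f x * g x) := by
  have hR : (0 : ℝ) < 2 * ((n : ℝ) + 1) := by positivity
  have c1 := (hχ n).1.cont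
  have c2 := (hχ n).1.dcont
  have hn := hYn n
  have i1 : IntervalIntegrable (fun x => χ n x ^ 2 * (Y x - Yn n x) * (f x * g x)) volume
      (-(2 * ((n : ℝ) + 1))) (2 * ((n : ℝ) + 1)) := by
    refine IntervalIntegrable.mul_continuousOn ?_ (by fun_prop)
    exact ((hYi _ _).sub (ii hR hn.continuousOn)).continuousOn_mul (by fun_prop)
  unfold Mat
  rw [intervalIntegral.integral_add ((ii hR (by fun_prop)).add i1) (ii hR (by fun_prop)),
    intervalIntegral.integral_add (ii hR (by fun_prop)) i1, intervalIntegral.integral_const_mul]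

lemma mat_bound (hD : 0 < D) (hχ : CutD D χ) (hYi : ∀ a b, IntervalIntegrable Y volume a b)
    (hYn : ∀ n, Continuous (Yn n)) (hZ : ∀ n : ℕ, Integrable (fun x => (Y x - Yn n x) ^ 2) ∧
    ∫ x, (Y x - Yn n x) ^ 2 ≤ 1 / ((n : ℝ) + 1) ^ 2) {E' B : ℝ} {f g : ℝ → ℝ}
    (hf : Continuous f) (hg : Continuous g) (hf2 : Integrable (fun x => f x ^ 2))
    (hg2 : Integrable (fun x => g x ^ 2)) (hB : ∀ x, f x ^ 2 ≤ B) : ∃ A : ℝ, ∀ n : ℕ,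
    |Mat χ Y Yn e E' f g n - (E' - e) * (∫ x in (-(2 * ((n : ℝ) + 1)))..(2 * ((n : ℝ) + 1)),
      χ n x ^ 2 * f x * g x)| ≤ A * (1 / ((n : ℝ) + 1)) := by
  refine ⟨D ^ 2 * ((∫ x, f x ^ 2) + ∫ x, g x ^ 2) + (B + ∫ x, g x ^ 2), fun n => ?_⟩
  have hR : (0 : ℝ) < 2 * ((n : ℝ) + 1) := by positivity
  have hn : (0 : ℝ) < (n : ℝ) + 1 := by positivity
  have hn1 : (1 : ℝ) ≤ (n : ℝ) + 1 := by linarith [(Nat.cast_nonneg n : (0 : ℝ) ≤ n)]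
  rw [mat_split hχ hYi hYn hf hg, add_sub_cancel_right]
  refine (abs_add_le _ _).trans ?_
  have t1 := term1 hR (hχ n).1 (hχ n).2.2.1 hf hg hf2 hg2
  have t2 := term2 hR (hχ n).1 (hχ n).2.1 hg hB hn (hZ n).1 hg2
  have hB0 : 0 ≤ B := (sq_nonneg _).trans (hB 0)
  have hP0 : 0 ≤ (∫ x, f x ^ 2) + ∫ x, g x ^ 2 :=
    add_nonneg (integral_nonneg fun x => sq_nonneg _) (integral_nonneg fun x => sq_nonneg _)
  have h3 : ((n : ℝ) + 1) * B * (∫ x, (Y x - Yn n x) ^ 2) ≤ B * (1 / ((n : ℝ) + 1)) := by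
    calc _ ≤ ((n : ℝ) + 1) * B * (1 / ((n : ℝ) + 1) ^ 2) := by
          have := (hZ n).2
          gcongr
      _ = _ := by field_simp
  have h4 : (D / ((n : ℝ) + 1)) ^ 2 ≤ D ^ 2 * (1 / ((n : ℝ) + 1)) := by
    rw [div_pow, mul_one_div]
    gcongr
    nlinarith
  have h5 := mul_le_mul_of_nonneg_right h4 hP0
  have h6 : (∫ x, g x ^ 2) / ((n : ℝ) + 1) = (∫ x, g x ^ 2) * (1 / ((n : ℝ) + 1)) := by ring
  rw [h6] at t2
  nlinarith

lemma mat_off (hD : 0 < D) (hχ : CutD D χ)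
    (hWU : ∀ x, W x ≤ W0 x + Y x) (hW0 : Continuous W0) (hW1 : ∀ x, W0 x ≤ c0)
    (hYi : ∀ a b, IntervalIntegrable Y volume a b) (hY : Integrable (fun x => Y x ^ 2))
    (hYn : ∀ n, Continuous (Yn n)) (hZ : ∀ n : ℕ, Integrable (fun x => (Y x - Yn n x) ^ 2) ∧
    ∫ x, (Y x - Yn n x) ^ 2 ≤ 1 / ((n : ℝ) + 1) ^ 2) {E E' : ℝ} {f f2 g g2 : ℝ → ℝ}
    (hf : EigD W E f f2) (hg : EigD W E' g g2) (hne : E ≠ E') :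
    Tendsto (fun n => Mat χ Y Yn e E' f g n) atTop (𝓝 0) := by
  obtain ⟨C, B, hC, hB⟩ := eig_bounds hD hχ hWU hW0 hW1 hYi hY hf
  obtain ⟨C', B', hC', hB'⟩ := eig_bounds hD hχ hWU hW0 hW1 hYi hY hg
  obtain ⟨A, hA⟩ := mat_bound (e := e) (E' := E') hD hχ hYi hYn hZ hf.1.cont hg.1.cont hf.2.1 hg.2.1 hB
  set K := D * ((1 + 2 * D ^ 2) * ((∫ x, f x ^ 2) + ∫ x, g x ^ 2) + 2 * C + 2 * C') with hK
  have hz : Tendsto (fun n : ℕ => (A + |E' - e| * (K / |E - E'|)) * (1 / ((n : ℝ) + 1))) atTop (𝓝 0) := by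
    simpa using (tendsto_one_div_add_atTop_nhds_zero_nat (𝕜 := ℝ)).const_mul
      (A + |E' - e| * (K / |E - E'|))
  refine squeeze_zero_norm (fun n => ?_) hz
  have ho := orth_bound (R := 2 * ((n : ℝ) + 1)) (by positivity) (hχ n).1 (hχ n).2.1 (hχ n).2.2.1
    (D := D) (div_le_self hD.le (by linarith [(Nat.cast_nonneg n : (0 : ℝ) ≤ n)]))
    hf.1 hg.1 hf.2.1 hg.2.1 hf.2.2.2 hg.2.2.2 (hC n) (hC' n)
  have hpos : 0 < |E - E'| := abs_pos.2 (sub_ne_zero.2 hne)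
  have hA := hA n
  set I := ∫ x in (-(2 * ((n : ℝ) + 1)))..(2 * ((n : ℝ) + 1)), χ n x ^ 2 * f x * g x
  have hI : |I| ≤ (K / |E - E'|) * (1 / ((n : ℝ) + 1)) := by
    rw [abs_mul] at ho
    have : |E - E'| * |I| ≤ K * (1 / ((n : ℝ) + 1)) := by
      refine ho.trans (le_of_eq ?_)
      rw [hK]; ring
    rw [div_mul_eq_mul_div, le_div_iff₀ hpos]
    linarith
  rw [Real.norm_eq_abs]
  calc |Mat χ Y Yn e E' f g n| = |(Mat χ Y Yn e E' f g n - (E' - e) * I) + (E' - e) * I| := by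
        rw [sub_add_cancel]
    _ ≤ |Mat χ Y Yn e E' f g n - (E' - e) * I| + |(E' - e) * I| := abs_add_le _ _
    _ ≤ A * (1 / ((n : ℝ) + 1)) + |E' - e| * ((K / |E - E'|) * (1 / ((n : ℝ) + 1))) := by
        rw [abs_mul]; gcongr
    _ = _ := by ring

lemma mat_diag (hD : 0 < D) (hχ : CutD D χ)
    (hWU : ∀ x, W x ≤ W0 x + Y x) (hW0 : Continuous W0) (hW1 : ∀ x, W0 x ≤ c0)
    (hYi : ∀ a b, IntervalIntegrable Y volume a b) (hY : Integrable (fun x => Y x ^ 2))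
    (hYn : ∀ n, Continuous (Yn n)) (hZ : ∀ n : ℕ, Integrable (fun x => (Y x - Yn n x) ^ 2) ∧
    ∫ x, (Y x - Yn n x) ^ 2 ≤ 1 / ((n : ℝ) + 1) ^ 2) {E : ℝ} {f f2 : ℝ → ℝ}
    (hf : EigD W E f f2) (hf0 : f ≠ 0) (hEe : E < e) :
    ∃ m : ℝ, 0 < m ∧ ∀ᶠ n in atTop, Mat χ Y Yn e E f f n ≤ -m := by
  obtain ⟨C, B, hC, hB⟩ := eig_bounds hD hχ hWU hW0 hW1 hYi hY hf
  obtain ⟨A, hA⟩ := mat_bound (e := e) (E' := E) hD hχ hYi hYn hZ hf.1.cont hf.1.cont hf.2.1 hf.2.1 hB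
  obtain ⟨x0, hx0⟩ := Function.ne_iff.1 hf0
  obtain ⟨n0, hn0⟩ := exists_nat_ge |x0|
  have c3 := hf.1.cont
  set r : ℝ := (n0 : ℝ) + 1 with hr
  have hr0 : 0 < r := by positivity
  have hm : 0 < ∫ x in (-r)..r, f x ^ 2 := by
    refine intervalIntegral.integral_pos (by linarith) (by fun_prop) (fun x _ => sq_nonneg _)
      ⟨x0, ?_, ?_⟩
    · have := abs_le.1 hn0
      constructor <;> linarith [this.1, this.2]
    · have : f x0 ≠ 0 := hx0
      positivity
  set m := ∫ x in (-r)..r, f x ^ 2 with hmdef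
  have hz : Tendsto (fun n : ℕ => A * (1 / ((n : ℝ) + 1))) atTop (𝓝 0) := by
    simpa using (tendsto_one_div_add_atTop_nhds_zero_nat (𝕜 := ℝ)).const_mul A
  have hp : 0 < (e - E) * m / 2 := by
    have : 0 < e - E := by linarith
    positivity
  refine ⟨(e - E) * m / 2, hp, ?_⟩
  filter_upwards [hz.eventually (ge_mem_nhds hp), eventually_ge_atTop n0] with n h1 h2
  have hnn : (n0 : ℝ) ≤ n := Nat.cast_le.2 h2
  have hR : (0 : ℝ) < 2 * ((n : ℝ) + 1) := by positivity
  have hrR : r ≤ 2 * ((n : ℝ) + 1) := by rw [hr]; linarith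
  have c1 := (hχ n).1.cont
  have hI : m ≤ ∫ x in (-(2 * ((n : ℝ) + 1)))..(2 * ((n : ℝ) + 1)), χ n x ^ 2 * f x * f x := by
    calc m = ∫ x in (-r)..r, χ n x ^ 2 * f x * f x := by
          rw [hmdef]
          apply intervalIntegral.integral_congr
          intro x hx
          rw [uIcc_of_le (by linarith)] at hx
          have : |x| ≤ (n : ℝ) + 1 := abs_le.2 ⟨by linarith [hx.1], by linarith [hx.2]⟩
          simp only [(hχ n).2.2.2 x this]
          ring
      _ ≤ _ := by
          refine intervalIntegral.integral_mono_interval (by linarith) (by linarith) hrR ?_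
            (ii hR (by fun_prop))
          exact Filter.Eventually.of_forall fun x => by
            have : χ n x ^ 2 * f x * f x = (χ n x * f x) ^ 2 := by ring
            simp only [this]
            exact sq_nonneg _
  have h3 := (abs_le.1 (hA n)).2
  have h4 := mul_le_mul_of_nonneg_left hI (by linarith : 0 ≤ e - E)
  linarith

lemma form_le {ι : Type*} [Fintype ι] (hχ : CutD D χ)
    (hWU : ∀ x, W x ≤ W0 x + Y x) (hW0 : Continuous W0)
    (hYi : ∀ a b, IntervalIntegrable Y volume a b)
    (hYn : ∀ n, Continuous (Yn n)) {E : ι → ℝ} {ψ ψ2 : ι → ℝ → ℝ}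
    (h : ∀ i, EigD W (E i) (ψ i) (ψ2 i)) (n : ℕ) (c : ι → ℝ) :
    qf (2 * ((n : ℝ) + 1)) (fun x => W0 x + Yn n x) (fun x => χ n x * ∑ i, c i * ψ i x)
      - e * nf (2 * ((n : ℝ) + 1)) (fun x => χ n x * ∑ i, c i * ψ i x)
      ≤ ∑ i, ∑ j, c i * c j * Mat χ Y Yn e (E j) (ψ i) (ψ j) n := by
  set R := 2 * ((n : ℝ) + 1) with hRdef
  have hR : 0 < R := by positivity
  have c1 := (hχ n).1.cont
  have c2 := (hχ n).1.dcont
  have hn := hYn n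
  have cψ : ∀ i, Continuous (ψ i) := fun i => (h i).1.cont
  have hsd := SD.sum (fun i => (h i).1) c
  have cf : Continuous (fun x => ∑ i, c i * ψ i x) := hsd.cont
  have hadm := adm_mul (hχ n).1 hsd.1
  have cd := hadm.dcont
  have ca := hadm.cont
  have hEc : Continuous (fun x => ∑ j, E j * c j * ψ j x) :=
    continuous_finsetSum _ fun i _ => continuous_const.mul (cψ i)
  have hae : ∀ᵐ x : ℝ, -(∑ i, c i * ψ2 i x) - W x * (∑ i, c i * ψ i x) = ∑ j, E j * c j * ψ j x := by
    have := fun i => (h i).2.2.2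
    filter_upwards [eventually_countable_forall.2 this] with x hx
    rw [Finset.mul_sum, ← Finset.sum_neg_distrib, ← Finset.sum_sub_distrib]
    refine Finset.sum_congr rfl fun i _ => ?_
    linear_combination c i * hx i
  have hUi : IntervalIntegrable (fun x => W0 x + Y x) volume (-R) R :=
    (ii hR hW0.continuousOn).add (hYi _ _)
  have hen := energy hR (χ := χ n) (U := fun x => W0 x + Y x) (hχ n).1 hsd hae hWU hUi hEc
  set f := fun x => ∑ i, c i * ψ i x with hf
  set ee := fun x => ∑ j, E j * c j * ψ j x with hee
  have i1 : IntervalIntegrable (fun x => deriv (χ n) x ^ 2 * f x ^ 2 + (W0 x + Y x) * (χ n x ^ 2 * f x ^ 2)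
      + χ n x ^ 2 * f x * ee x) volume (-R) R := by
    refine ((ii hR (by fun_prop)).add ?_).add (ii hR (by fun_prop))
    exact hUi.mul_continuousOn (by fun_prop)
  have e1 : qf R (fun x => W0 x + Yn n x) (fun x => χ n x * f x) - e * nf R (fun x => χ n x * f x)
      = (∫ x in (-R)..R, (deriv (fun x => χ n x * f x) x) ^ 2)
        - ∫ x in (-R)..R, (W0 x + Yn n x + e) * (χ n x ^ 2 * f x ^ 2) := by
    unfold qf nf
    rw [intervalIntegral.integral_sub (ii hR (by fun_prop)) (ii hR (by fun_prop)),
      ← intervalIntegral.integral_const_mul, sub_sub,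
      ← intervalIntegral.integral_add (ii hR (by fun_prop)) (ii hR (by fun_prop))]
    congr 2; ext x; ring
  have e2 : (∫ x in (-R)..R, (deriv (χ n) x ^ 2 * f x ^ 2 + (W0 x + Y x) * (χ n x ^ 2 * f x ^ 2)
      + χ n x ^ 2 * f x * ee x)) - ∫ x in (-R)..R, (W0 x + Yn n x + e) * (χ n x ^ 2 * f x ^ 2)
      = ∑ i, ∑ j, c i * c j * Mat χ Y Yn e (E j) (ψ i) (ψ j) n := by
    rw [← intervalIntegral.integral_sub i1 (ii hR (by fun_prop))]
    have iij : ∀ i j, IntervalIntegrable (fun x => c i * c j * (deriv (χ n) x ^ 2 * (ψ i x * ψ j x)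
        + χ n x ^ 2 * (Y x - Yn n x) * (ψ i x * ψ j x)
        + (E j - e) * (χ n x ^ 2 * ψ i x * ψ j x))) volume (-R) R := by
      intro i j
      refine IntervalIntegrable.const_mul ?_ _
      have := cψ i
      have := cψ j
      refine ((ii hR (by fun_prop)).add ?_).add (ii hR (by fun_prop))
      refine IntervalIntegrable.mul_continuousOn ?_ (by fun_prop)
      exact ((hYi _ _).sub (ii hR hn.continuousOn)).continuousOn_mul (by fun_prop)
    have iis : ∀ i, IntervalIntegrable (fun x => ∑ j, c i * c j * (deriv (χ n) x ^ 2 * (ψ i x * ψ j x)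
        + χ n x ^ 2 * (Y x - Yn n x) * (ψ i x * ψ j x)
        + (E j - e) * (χ n x ^ 2 * ψ i x * ψ j x))) volume (-R) R := by
      intro i
      refine (IntervalIntegrable.sum Finset.univ (fun j _ => iij i j)).congr ?_
      intro x _
      simp
    have e3 : ∑ i, ∑ j, c i * c j * Mat χ Y Yn e (E j) (ψ i) (ψ j) n
        = ∫ x in (-R)..R, ∑ i, ∑ j, c i * c j * (deriv (χ n) x ^ 2 * (ψ i x * ψ j x)
        + χ n x ^ 2 * (Y x - Yn n x) * (ψ i x * ψ j x)
        + (E j - e) * (χ n x ^ 2 * ψ i x * ψ j x)) := by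
      rw [intervalIntegral.integral_finsetSum (fun i _ => iis i)]
      refine Finset.sum_congr rfl fun i _ => ?_
      rw [intervalIntegral.integral_finsetSum (fun j _ => iij i j)]
      refine Finset.sum_congr rfl fun j _ => ?_
      rw [intervalIntegral.integral_const_mul]
      rfl
    rw [e3]
    congr 1; ext x
    have s1 : f x ^ 2 = ∑ i, ∑ j, (c i * ψ i x) * (c j * ψ j x) := by
      rw [sq, hf, Finset.sum_mul_sum]
    have s2 : f x * ee x = ∑ i, ∑ j, (c i * ψ i x) * (E j * c j * ψ j x) := by
      rw [hf, hee, Finset.sum_mul_sum]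
    have s3 : deriv (χ n) x ^ 2 * f x ^ 2 + (W0 x + Y x) * (χ n x ^ 2 * f x ^ 2)
      + χ n x ^ 2 * f x * ee x - (W0 x + Yn n x + e) * (χ n x ^ 2 * f x ^ 2)
      = (deriv (χ n) x ^ 2 + χ n x ^ 2 * (Y x - Yn n x) - e * χ n x ^ 2) * f x ^ 2
        + χ n x ^ 2 * (f x * ee x) := by ring
    rw [s3, s1, s2]
    simp only [Finset.mul_sum, ← Finset.sum_add_distrib]
    refine Finset.sum_congr rfl fun i _ => Finset.sum_congr rfl fun j _ => ?_
    ring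
  rw [e1, ← e2]
  linarith

lemma Tst_ev {ι : Type*} [Fintype ι] (hD : 0 < D) (hχ : CutD D χ)
    (hWU : ∀ x, W x ≤ W0 x + Y x) (hW0 : Continuous W0) (hW1 : ∀ x, W0 x ≤ c0)
    (hYi : ∀ a b, IntervalIntegrable Y volume a b) (hY : Integrable (fun x => Y x ^ 2))
    (hYn : ∀ n, Continuous (Yn n)) (hZ : ∀ n : ℕ, Integrable (fun x => (Y x - Yn n x) ^ 2) ∧
    ∫ x, (Y x - Yn n x) ^ 2 ≤ 1 / ((n : ℝ) + 1) ^ 2) {E : ι → ℝ} {ψ ψ2 : ι → ℝ → ℝ}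
    (h : ∀ i, EigD W (E i) (ψ i) (ψ2 i)) (h0 : ∀ i, ψ i ≠ 0) (hinj : Function.Injective E)
    (he : e < 0) (hEe : ∀ i, E i < e) :
    ∀ᶠ n : ℕ in atTop, Tst (2 * ((n : ℝ) + 1)) (fun x => W0 x + Yn n x) (Fintype.card ι) (√(-e)) := by
  choose m hm0 hm using fun i => mat_diag hD hχ hWU hW0 hW1 hYi hY hYn hZ (h i) (h0 i) (hEe i)
  have hoff : ∀ i j, i ≠ j → Tendsto (fun n => Mat χ Y Yn e (E j) (ψ i) (ψ j) n) atTop (𝓝 0) :=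
    fun i j hij => mat_off hD hχ hWU hW0 hW1 hYi hY hYn hZ (h i) (h j) (fun hE => hij (hinj hE))
  filter_upwards [negdef (fun n i j => Mat χ Y Yn e (E j) (ψ i) (ψ j) n) m hm0 hoff hm] with n hn
  have hl : -(√(-e)) ^ 2 = e := by rw [Real.sq_sqrt (by linarith)]; ring
  set R := 2 * ((n : ℝ) + 1) with hRdef
  let T : (ι → ℝ) →ₗ[ℝ] (ℝ → ℝ) :=
    { toFun := fun c x => χ n x * ∑ i, c i * ψ i x
      map_add' := by
        intro a b; ext x
        simp only [Pi.add_apply, add_mul, Finset.sum_add_distrib, mul_add]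
      map_smul' := by
        intro a b; ext x
        simp only [Pi.smul_apply, smul_eq_mul, RingHom.id_apply, mul_assoc, ← Finset.mul_sum]
        ring }
  have hT : ∀ c, T c = fun x => χ n x * ∑ i, c i * ψ i x := fun c => rfl
  have hform : ∀ c, qf R (fun x => W0 x + Yn n x) (T c) - e * nf R (T c)
      ≤ ∑ i, ∑ j, c i * c j * Mat χ Y Yn e (E j) (ψ i) (ψ j) n :=
    fun c => form_le hχ hWU hW0 hYi hYn h n c
  have hTi : Function.Injective T := by
    rw [injective_iff_map_eq_zero]
    intro c hc
    by_contra hne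
    have h1 := hform c
    have h2 := hn c hne
    rw [hc] at h1
    have h3 : qf R (fun x => W0 x + Yn n x) (0 : ℝ → ℝ) = 0 := by simp [qf]
    have h4 : nf R (0 : ℝ → ℝ) = 0 := by simp [nf]
    rw [h3, h4] at h1
    linarith
  refine ⟨LinearMap.range T, ?_, ?_⟩
  · rw [LinearMap.finrank_range_of_inj hTi, Module.finrank_fintype_fun_eq_card]
  · rintro _ ⟨c, rfl⟩
    refine ⟨adm_mul (hχ n).1 (SD.sum (fun i => (h i).1) c).1, ?_⟩
    rw [hl]
    have h1 := hform c
    by_cases hc : c = 0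
    · rw [hc] at h1 ⊢
      simp only [Pi.zero_apply, zero_mul, Finset.sum_const_zero] at h1
      linarith
    · linarith [hn c hc]

end

lemma sech_eq (x : ℝ) : (1 / Real.cosh x) ^ 2 = 1 - Real.tanh x ^ 2 := by
  have h := Real.cosh_sq x
  have hc := Real.cosh_pos x
  rw [Real.tanh_eq_sinh_div_cosh]
  field_simp
  linarith

lemma tail_bound (n : ℕ) : 4 / 3 - (2 * Real.tanh (2 * ((n : ℝ) + 1)) - 2 / 3 * Real.tanh (2 * ((n : ℝ) + 1)) ^ 3)
    ≤ 2 * (1 / ((n : ℝ) + 1)) := by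
  have hn : (0 : ℝ) < (n : ℝ) + 1 := by positivity
  set x := 2 * ((n : ℝ) + 1) with hx
  have hs := sech_eq x
  have h1 : (n : ℝ) + 1 ≤ Real.cosh x := by
    rw [Real.cosh_eq]
    have := Real.add_one_le_exp x
    have := (Real.exp_pos (-x)).le
    linarith
  have h2 : (1 / Real.cosh x) ^ 2 ≤ 1 / ((n : ℝ) + 1) := by
    have h3 : 1 / Real.cosh x ≤ 1 / ((n : ℝ) + 1) := one_div_le_one_div_of_le hn h1
    have h4 : 1 / Real.cosh x ≤ 1 := by
      rw [div_le_one (Real.cosh_pos x)]; exact Real.one_le_cosh x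
    have h5 : 0 ≤ 1 / Real.cosh x := (one_div_pos.2 (Real.cosh_pos x)).le
    nlinarith
  have hT1 : Real.tanh x ^ 2 < 1 := by
    have : 0 < (1 / Real.cosh x) ^ 2 := pow_pos (one_div_pos.2 (Real.cosh_pos x)) 2
    linarith
  have hT0 : 0 ≤ Real.tanh x := by
    rw [Real.tanh_eq_sinh_div_cosh]
    exact div_nonneg (Real.sinh_nonneg_iff.2 (by positivity)) (Real.cosh_pos x).le
  set T := Real.tanh x
  have hT2 : T < 1 := by nlinarith
  have hT3 : 4 / 3 - (2 * T - 2 / 3 * T ^ 3) ≤ 2 * (1 - T ^ 2) := by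
    have : T ^ 3 ≤ T ^ 2 := by nlinarith [sq_nonneg T]
    nlinarith [mul_nonneg hT0 (sub_nonneg.2 hT2.le), mul_nonneg (mul_nonneg hT0 hT0) (sub_nonneg.2 hT2.le)]
  linarith

lemma eps_bound (ν : ℝ) (hν : 0 < ν)
    (V : ℝ → ℝ) (hVplus : MemLp (fun x => max (V x) 0) 2 (volume : Measure ℝ))
    (N : ℕ) (E : Fin N → ℝ) (hEmono : StrictMono E)
    (hEeig : ∀ k, ∃ ψ ψ2 : ℝ → ℝ, ψ ≠ 0 ∧ 
      EigD (fun x => ν * (ν + 1) * (1 / Real.cosh x) ^ 2 + V x) (E k) ψ ψ2)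
    (ε : ℝ) (hε : 0 < ε) (hEε : ∀ k, E k + ε < 0) :
    ∑ k : Fin N, 16 / 3 * (if (k : ℕ) < Nat.ceil ν then (√(-(E k + ε)) - (ν - (k : ℕ))) ^ 3
         else √(-(E k + ε)) ^ 3) ≤ ∫ x : ℝ, (max (V x) 0) ^ 2 := by
  set Y := fun x => max (V x) 0 with hYdef
  set Q := ∫ x, Y x ^ 2 with hQ
  obtain ⟨D, hD, χ, hχ⟩ := cutoff_exists
  obtain ⟨Yn, hYn⟩ := approx hVplus
  choose ψ ψ2 hψ0 hψ using hEeig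
  have hY2 : Integrable (fun x => Y x ^ 2) := hVplus.integrable_sq
  have hYi : ∀ a b, IntervalIntegrable Y volume a b := by
    intro a b
    exact ((hVplus.locallyIntegrable one_le_two).integrableOn_isCompact isCompact_uIcc).intervalIntegrable
  set W0 : ℝ → ℝ := fun x => (ν * (ν + 1)) * (1 - Real.tanh x ^ 2) with hW0def
  have hW0 : Continuous W0 := by
    have := tanh_cont'
    fun_prop
  have hκ : 0 ≤ ν * (ν + 1) := by positivity
  have hW1 : ∀ x, W0 x ≤ ν * (ν + 1) := by
    intro x
    have := mul_nonneg hκ (sq_nonneg (Real.tanh x))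
    simp only [hW0def]
    linarith
  have hWU : ∀ x, (fun x => ν * (ν + 1) * (1 / Real.cosh x) ^ 2 + V x) x ≤ W0 x + Y x := by
    intro x
    simp only [sech_eq, hW0def, hYdef]
    have := le_max_left (V x) 0
    linarith
  let l : ℕ → ℝ := fun k => if h : k < N then √(-(E ⟨k, h⟩ + ε)) else 1
  have hev : ∀ᶠ n : ℕ in atTop, ∀ k < N, 0 < l k ∧
      Tst (2 * ((n : ℝ) + 1)) (fun x => W0 x + Yn n x) (k + 1) (l k) := by
    have : ∀ᶠ n : ℕ in atTop, ∀ k : Fin N, 0 < l k ∧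
      Tst (2 * ((n : ℝ) + 1)) (fun x => W0 x + Yn n x) (k + 1) (l k) := by
      rw [eventually_all]
      intro k
      have hlk : l k = √(-(E k + ε)) := by simp [l]
      have hle : (k : ℕ) + 1 ≤ N := k.2
      have := Tst_ev (ι := Fin ((k : ℕ) + 1)) (e := E k + ε) hD hχ hWU hW0 hW1 hYi hY2
        (fun n => (hYn n).1) (fun n => (hYn n).2.2)
        (E := fun i => E (Fin.castLE hle i)) (fun i => hψ (Fin.castLE hle i))
        (fun i => hψ0 (Fin.castLE hle i))
        (hEmono.injective.comp (Fin.castLE_injective hle)) (hEε k) (by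
          intro i
          have : E (Fin.castLE hle i) ≤ E k := hEmono.monotone (by
            rw [Fin.le_def]
            simp only [Fin.val_castLE]
            exact Nat.lt_succ_iff.1 i.2)
          linarith)
      filter_upwards [this] with n hn
      rw [hlk]
      refine ⟨Real.sqrt_pos.2 (by linarith [hEε k]), ?_⟩
      simpa using hn
    filter_upwards [this] with n hn k hk
    exact hn ⟨k, hk⟩
  have hsum : ∑ k : Fin N, 16 / 3 * (if (k : ℕ) < Nat.ceil ν then (√(-(E k + ε)) - (ν - (k : ℕ))) ^ 3
         else √(-(E k + ε)) ^ 3)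
      = ∑ k ∈ Finset.range N, 16 / 3 * (if k < Nat.ceil ν then (l k - (ν - k)) ^ 3 else l k ^ 3) := by
    rw [Finset.sum_range]
    refine Finset.sum_congr rfl fun k _ => ?_
    have hlk : l k = √(-(E k + ε)) := by simp [l]
    rw [hlk]
  rw [hsum]
  have hz := tendsto_one_div_add_atTop_nhds_zero_nat (𝕜 := ℝ)
  have hlim : Tendsto (fun n : ℕ => (1 + 1 / ((n : ℝ) + 1)) * Q + (1 / ((n : ℝ) + 1)) ^ 2 + 1 / ((n : ℝ) + 1)
      + (ν * (ν + 1)) ^ 2 * (2 * (1 / ((n : ℝ) + 1)))) atTop (𝓝 Q) := by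
    have := ((((hz.const_add 1).mul_const Q).add (hz.pow 2)).add hz).add
      ((hz.const_mul 2).const_mul ((ν * (ν + 1)) ^ 2))
    simpa using this
  refine ge_of_tendsto hlim ?_
  filter_upwards [hev] with n hn
  have hn0 : (0 : ℝ) < (n : ℝ) + 1 := by positivity
  have hR : (0 : ℝ) < 2 * ((n : ℝ) + 1) := by positivity
  have hc : Continuous (fun x => W0 x + Yn n x) := hW0.add (hYn n).1
  have hmain := LT_pt hR N hc l ν hν hn
  rw [Jf_eq hR hc] at hmain
  have e1 : ∀ x, (W0 x + Yn n x - (ν * (ν + 1)) * (1 - Real.tanh x ^ 2)) ^ 2 = Yn n x ^ 2 := by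
    intro x
    simp only [hW0def]; ring
  simp only [e1] at hmain
  have h1 : ∫ x in (-(2 * ((n : ℝ) + 1)))..(2 * ((n : ℝ) + 1)), Yn n x ^ 2 ≤ ∫ x, Yn n x ^ 2 :=
    int_le hR (hYn n).2.1 (fun x => sq_nonneg _)
  have h2 : ∫ x, Yn n x ^ 2 ≤ (1 + 1 / ((n : ℝ) + 1)) * Q
      + (1 + ((n : ℝ) + 1)) * ∫ x, (Y x - Yn n x) ^ 2 := by
    rw [hQ, ← integral_const_mul, ← integral_const_mul,
      ← integral_add (hY2.const_mul _) ((hYn n).2.2.1.const_mul _)]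
    refine integral_mono (hYn n).2.1 ((hY2.const_mul _).add ((hYn n).2.2.1.const_mul _)) ?_
    intro x
    simp only
    have h3 : 0 ≤ (Y x + ((n : ℝ) + 1) * (Y x - Yn n x)) ^ 2 / ((n : ℝ) + 1) := by positivity
    have h4 : (Y x + ((n : ℝ) + 1) * (Y x - Yn n x)) ^ 2 / ((n : ℝ) + 1)
      = (1 + 1 / ((n : ℝ) + 1)) * Y x ^ 2 + (1 + ((n : ℝ) + 1)) * (Y x - Yn n x) ^ 2 - Yn n x ^ 2 := by
      field_simp; ring
    linarith
  have h3 : (1 + ((n : ℝ) + 1)) * ∫ x, (Y x - Yn n x) ^ 2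
      ≤ (1 / ((n : ℝ) + 1)) ^ 2 + 1 / ((n : ℝ) + 1) := by
    calc _ ≤ (1 + ((n : ℝ) + 1)) * (1 / ((n : ℝ) + 1) ^ 2) := by
          have := (hYn n).2.2.2
          gcongr
      _ = _ := by field_simp
  have h4 := mul_le_mul_of_nonneg_left (tail_bound n) (sq_nonneg (ν * (ν + 1)))
  linarith


theorem poschl_teller_sum_dist_eigenvalues_le
    (ν : ℝ) (hν : 0 < ν)
    (V : ℝ → ℝ) (hVmeas : Measurable V)
    (hVplus : MemLp (fun x => max (V x) 0) 2 (volume : Measure ℝ))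
    (N : ℕ) (E : Fin N → ℝ)
    (hEmono : StrictMono E)
    (hEneg : ∀ k, E k < 0)
    (hEeig : ∀ k, IsEigenvalue
      (fun x => ν * (ν + 1) * (1 / Real.cosh x) ^ 2 + V x) (E k)) :
    ∑ k : Fin N,
        (if (k : ℕ) < Nat.ceil ν then (Real.sqrt |E k| - (ν - (k : ℕ))) ^ 3
         else |E k| ^ ((3 : ℝ) / 2))
      ≤ 3 / 16 * ∫ x : ℝ, (max (V x) 0) ^ 2 := by
  have hE' : ∀ k, ∃ ψ ψ2 : ℝ → ℝ, ψ ≠ 0 ∧ 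
      EigD (fun x => ν * (ν + 1) * (1 / Real.cosh x) ^ 2 + V x) (E k) ψ ψ2 := by
    intro k
    obtain ⟨ψ, ψ2, h0, h1, h2, h3, h4⟩ := hEeig k
    exact ⟨ψ, ψ2, h0, ⟨h2, h3⟩, h1.integrable_sq, hEneg k, h4⟩
  have hlim : Tendsto (fun ε : ℝ => ∑ k : Fin N, 16 / 3 * (if (k : ℕ) < Nat.ceil ν
      then (√(-(E k + ε)) - (ν - (k : ℕ))) ^ 3 else √(-(E k + ε)) ^ 3)) (𝓝[>] 0)
      (𝓝 (∑ k : Fin N, 16 / 3 * (if (k : ℕ) < Nat.ceil ν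
      then (√(-(E k + 0)) - (ν - (k : ℕ))) ^ 3 else √(-(E k + 0)) ^ 3))) := by
    refine Tendsto.mono_left ?_ nhdsWithin_le_nhds
    refine Continuous.tendsto ?_ 0
    refine continuous_finsetSum _ fun k _ => ?_
    split_ifs <;> fun_prop
  have hev : ∀ᶠ ε : ℝ in 𝓝[>] 0, ∑ k : Fin N, 16 / 3 * (if (k : ℕ) < Nat.ceil ν
      then (√(-(E k + ε)) - (ν - (k : ℕ))) ^ 3 else √(-(E k + ε)) ^ 3)
      ≤ ∫ x : ℝ, (max (V x) 0) ^ 2 := by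
    have h1 : ∀ᶠ ε : ℝ in 𝓝[>] 0, ∀ k, E k + ε < 0 := by
      rw [eventually_all]
      intro k
      have : ∀ᶠ ε : ℝ in 𝓝 0, ε < -E k := gt_mem_nhds (by linarith [hEneg k])
      filter_upwards [nhdsWithin_le_nhds this] with ε hε
      linarith
    filter_upwards [h1, self_mem_nhdsWithin] with ε h1 h2
    exact eps_bound ν hν V hVplus N E hEmono hE' ε h2 h1
  have hfin := le_of_tendsto hlim hev
  rw [← Finset.mul_sum] at hfin
  have heq : ∑ k : Fin N,
        (if (k : ℕ) < Nat.ceil ν then (Real.sqrt |E k| - (ν - (k : ℕ))) ^ 3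
         else |E k| ^ ((3 : ℝ) / 2)) = ∑ k : Fin N, (if (k : ℕ) < Nat.ceil ν
      then (√(-(E k + 0)) - (ν - (k : ℕ))) ^ 3 else √(-(E k + 0)) ^ 3) := by
    refine Finset.sum_congr rfl fun k _ => ?_
    have ha : |E k| = -(E k + 0) := by rw [add_zero, abs_of_neg (hEneg k)]
    have hb : |E k| ^ ((3 : ℝ) / 2) = √|E k| ^ 3 := by
      rw [Real.sqrt_eq_rpow, ← Real.rpow_natCast, ← Real.rpow_mul (abs_nonneg _)]
      norm_num
    rw [hb, ha]
  rw [heq]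
  linarith
end

section
/- Let λ, μ ≥ 0 and let V : ℝ → ℝ be in L²(ℝ). Let g, f : ℝ → ℝ be locally absolutely continuous with f′(x) = λ − μ − V(x) − f(x)² − 2g(x)f(x) for almost every x, lim_{x→+∞} f(x) = −(√λ − √μ), lim_{x→−∞} f(x) = √λ − √μ, lim_{x→+∞} g(x) = −√μ, lim_{x→−∞} g(x) = +√μ. Assume g′f² is integrable on ℝ and V + 2f′ ∈ L²(ℝ). Then (8/3)(√λ − √μ)²(2√λ + √μ) ≤ ∫_ℝ V(x)² dx + 4 ∫_ℝ g′(x) f(x)² dx. (Equivalently, the left-hand side equals (8/3)(2λ^{3/2} − 3λ√μ + μ^{3/2}).) -/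
open MeasureTheory Real Filter Set
open scoped Topology

theorem prim_ac {u u' : ℝ → ℝ}
    (h : ∀ a b : ℝ, IntervalIntegrable u' volume a b ∧ ∫ x in a..b, u' x = u b - u a)
    (a b : ℝ) : AbsolutelyContinuousOnInterval u a b ∧
      ∀ᵐ x, x ∈ uIcc a b → HasDerivAt u (u' x) x := by
  have hu : u = fun x => (∫ t in a..x, u' t) + u a := by
    funext x
    rw [(h a x).2]; ring
  constructor
  · have h1 := (h a b).1.absolutelyContinuousOnInterval_intervalIntegral (c := a) (by simp)
    have h2 : AbsolutelyContinuousOnInterval (fun _ : ℝ => u a) a b :=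
      (contDiff_const.contDiffOn (n := 1)).absolutelyContinuousOnInterval
    rw [hu]
    exact h1.add h2
  · filter_upwards [(h a b).1.ae_hasDerivAt_integral] with x hx hm
    rw [hu]
    exact (hx hm a (by simp)).add_const _

theorem prim_mul {u u' v v' : ℝ → ℝ}
    (hu : ∀ a b : ℝ, IntervalIntegrable u' volume a b ∧ ∫ x in a..b, u' x = u b - u a)
    (hv : ∀ a b : ℝ, IntervalIntegrable v' volume a b ∧ ∫ x in a..b, v' x = v b - v a) :
    ∀ a b : ℝ, IntervalIntegrable (fun x => u' x * v x + u x * v' x) volume a b ∧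
      ∫ x in a..b, (u' x * v x + u x * v' x) = u b * v b - u a * v a := by
  intro a b
  obtain ⟨hua, hud⟩ := prim_ac hu a b
  obtain ⟨hva, hvd⟩ := prim_ac hv a b
  refine ⟨((hu a b).1.mul_continuousOn hva.continuousOn).add
      ((hv a b).1.continuousOn_mul hua.continuousOn), ?_⟩
  rw [← hua.integral_deriv_mul_eq_sub hva]
  apply intervalIntegral.integral_congr_ae
  filter_upwards [hud, hvd] with x h1 h2 h3
  have h4 : x ∈ uIcc a b := uIoc_subset_uIcc h3
  rw [(h1 h4).deriv, (h2 h4).deriv]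

theorem riccati_integral_inequality
    (lam μ : ℝ) (hlam : 0 ≤ lam) (hμ : 0 ≤ μ)
    (V g f g' f' : ℝ → ℝ)
    (hV : MemLp V 2 (volume : Measure ℝ))
    -- g is locally absolutely continuous with a.e. derivative g'
    (hgAC : ∀ a b : ℝ, IntervalIntegrable g' volume a b ∧
      ∫ x in a..b, g' x = g b - g a)
    -- f is locally absolutely continuous with a.e. derivative f'
    (hfAC : ∀ a b : ℝ, IntervalIntegrable f' volume a b ∧
      ∫ x in a..b, f' x = f b - f a)
    (hfeq : ∀ᵐ x : ℝ ∂volume,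
      f' x = lam - μ - V x - f x ^ 2 - 2 * g x * f x)
    (hftop : Tendsto f atTop (𝓝 (-(Real.sqrt lam - Real.sqrt μ))))
    (hfbot : Tendsto f atBot (𝓝 (Real.sqrt lam - Real.sqrt μ)))
    (hgtop : Tendsto g atTop (𝓝 (-Real.sqrt μ)))
    (hgbot : Tendsto g atBot (𝓝 (Real.sqrt μ)))
    (hint : Integrable (fun x => g' x * f x ^ 2) (volume : Measure ℝ))
    (hVf : MemLp (fun x => V x + 2 * f' x) 2 (volume : Measure ℝ)) :
    8 / 3 * (Real.sqrt lam - Real.sqrt μ) ^ 2 * (2 * Real.sqrt lam + Real.sqrt μ)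
      ≤ (∫ x : ℝ, V x ^ 2) + 4 * ∫ x : ℝ, g' x * f x ^ 2 := by
  set s := Real.sqrt lam with hs
  set t := Real.sqrt μ with ht
  have hs2 : s ^ 2 = lam := Real.sq_sqrt hlam
  have ht2 : t ^ 2 = μ := Real.sq_sqrt hμ
  have hff := prim_mul hfAC hfAC
  have hfff := prim_mul hff hfAC
  have hgff := prim_mul hgAC hff
  have hV2 : Integrable (fun x => V x ^ 2) volume := hV.integrable_sq
  have hW : Integrable (fun x => V x ^ 2 + 4 * (g' x * f x ^ 2)) volume :=
    hV2.add (hint.const_mul 4)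
  have key : ∀ n : ℝ, 0 ≤ n → 0 ≤ (∫ x in (-n)..n, (V x ^ 2 + 4 * (g' x * f x ^ 2)))
      + 4 * ((lam - μ) * (f n - f (-n)) - (f n * f n * f n - f (-n) * f (-n) * f (-n)) / 3
        - (g n * (f n * f n) - g (-n) * (f (-n) * f (-n)))) := by
    intro n hn
    obtain ⟨i1, e1⟩ := hfAC (-n) n
    obtain ⟨i2, e2⟩ := hfff (-n) n
    obtain ⟨i3, e3⟩ := hgff (-n) n
    have i0 : IntervalIntegrable (fun x => V x ^ 2 + 4 * (g' x * f x ^ 2)) volume (-n) n :=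
      hW.intervalIntegrable
    rw [← e1, ← e2, ← e3, ← intervalIntegral.integral_const_mul,
      ← intervalIntegral.integral_div,
      ← intervalIntegral.integral_sub (i1.const_mul _) (i2.div_const _),
      ← intervalIntegral.integral_sub ((i1.const_mul _).sub (i2.div_const _)) i3,
      ← intervalIntegral.integral_const_mul,
      ← intervalIntegral.integral_add i0
        ((((i1.const_mul _).sub (i2.div_const _)).sub i3).const_mul _)]
    apply intervalIntegral.integral_nonneg_of_ae (by linarith)
    filter_upwards [hfeq] with x hx
    have hVx : V x = lam - μ - f' x - f x ^ 2 - 2 * g x * f x := by linarith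
    have := sq_nonneg (V x + 2 * f' x)
    simp only [Pi.zero_apply]
    calc (0:ℝ) ≤ (V x + 2 * f' x) ^ 2 := this
      _ = _ := by rw [hVx]; ring
  have hfb := hfbot.comp tendsto_neg_atTop_atBot
  have hgb := hgbot.comp tendsto_neg_atTop_atBot
  have hI := intervalIntegral_tendsto_integral hW tendsto_neg_atTop_atBot tendsto_id
  have hlim := hI.add ((((((hftop.sub hfb).const_mul (lam - μ))).sub
    ((((hftop.mul hftop).mul hftop).sub ((hfb.mul hfb).mul hfb)).div_const 3)).sub
    ((hgtop.mul (hftop.mul hftop)).sub (hgb.mul (hfb.mul hfb)))).const_mul 4)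
  have hfin := ge_of_tendsto hlim ((eventually_ge_atTop (0:ℝ)).mono fun n hn => key n hn)
  rw [integral_add hV2 (hint.const_mul 4), integral_const_mul] at hfin
  rw [← hs2, ← ht2] at hfin
  linarith
end

section
/- Let μ > 0 and let V₀ : ℝ → ℝ be measurable with V₀(x) ≥ 0 for all x and single-well. Let g : ℝ → ℝ be locally absolutely continuous with g′(x) = μ − V₀(x) − g(x)² for almost every x ∈ ℝ, lim_{x→+∞} g(x) = −√μ and lim_{x→−∞} g(x) = +√μ. Then g′(x) ≤ 0 for almost every x ∈ ℝ; equivalently, g is non-increasing on ℝ. -/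
open MeasureTheory Real Filter Set
open scoped Topology

theorem half_aux
    (μ : ℝ) (V₀ : ℝ → ℝ)
    (hV₀nonneg : ∀ x, 0 ≤ V₀ x) (c : ℝ) (hanti : AntitoneOn V₀ (Set.Ici c))
    (g g' : ℝ → ℝ)
    (hgAC : ∀ a b : ℝ, IntervalIntegrable g' volume a b ∧
      ∫ x in a..b, g' x = g b - g a)
    (hgeq : ∀ᵐ x : ℝ ∂volume, g' x = μ - V₀ x - g x ^ 2)
    (hgtop : Tendsto g atTop (𝓝 (-Real.sqrt μ))) (x₀ : ℝ) (hx₀ : c ≤ x₀) :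
    μ - V₀ x₀ - g x₀ ^ 2 ≤ 0 := by
  by_contra! hpos
  have hcont : Continuous g := by
    have h1 : Continuous fun b => ∫ x in (0:ℝ)..b, g' x :=
      intervalIntegral.continuous_primitive (fun a b => (hgAC a b).1) 0
    have h2 : g = fun b => (∫ x in (0:ℝ)..b, g' x) + g 0 := by
      funext b
      rw [(hgAC 0 b).2]; ring
    rw [h2]
    exact h1.add continuous_const
  have hclaim : ∀ x₁, x₀ ≤ x₁ → g x₀ ≤ g x₁ := by
    intro x₁ hx₁
    have hcl : IsClosed ({x | g x₀ ≤ g x} ∩ Icc x₀ x₁) :=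
      (isClosed_le continuous_const hcont).inter isClosed_Icc
    have hsub := hcl.Icc_subset_of_forall_mem_nhdsWithin (le_refl (g x₀)) (by
      rintro x ⟨hx, hx0, hx1⟩
      rcases lt_or_eq_of_le (show g x₀ ≤ g x from hx) with hlt | heq
      · have h1 : {y | g x₀ < g y} ∈ 𝓝 x :=
          (isOpen_lt continuous_const hcont).mem_nhds hlt
        refine mem_nhdsWithin_of_mem_nhds (mem_of_superset h1 ?_)
        intro y hy
        exact le_of_lt (show g x₀ < g y from hy)
      · have hop : {y | g y ^ 2 < μ - V₀ x₀} ∈ 𝓝 x :=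
          (isOpen_lt (hcont.pow 2) continuous_const).mem_nhds (by
            show g x ^ 2 < _
            rw [← heq]; linarith)
        obtain ⟨ε, hε, hball⟩ := Metric.mem_nhds_iff.1 hop
        have : Ioo x (x + ε) ∈ 𝓝[>] x := Ioo_mem_nhdsGT (by linarith)
        refine mem_of_superset this ?_
        rintro y ⟨hy1, hy2⟩
        show g x₀ ≤ g y
        have hi : 0 ≤ ∫ t in x..y, g' t := by
          apply intervalIntegral.integral_nonneg_of_ae_restrict hy1.le
          filter_upwards [ae_restrict_of_ae hgeq, ae_restrict_mem measurableSet_Icc] with t ht htm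
          have h1 : g t ^ 2 < μ - V₀ x₀ := hball (by
            rw [Metric.mem_ball, Real.dist_eq, abs_lt]
            constructor <;> linarith [htm.1, htm.2])
          have h2 : V₀ t ≤ V₀ x₀ := hanti hx₀ (by
            show c ≤ t
            linarith [htm.1]) (by linarith [htm.1])
          show 0 ≤ g' t
          rw [ht]; linarith
        rw [(hgAC x y).2] at hi
        linarith)
    exact hsub ⟨hx₁, le_refl _⟩
  have hlim : g x₀ ≤ -Real.sqrt μ :=
    ge_of_tendsto hgtop ((eventually_ge_atTop x₀).mono hclaim)
  have hμ : 0 ≤ μ := by nlinarith [hV₀nonneg x₀, sq_nonneg (g x₀)]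
  nlinarith [hV₀nonneg x₀, Real.sq_sqrt hμ, Real.sqrt_nonneg μ]

theorem riccati_single_well_log_derivative_antitone
    (μ : ℝ) (hμ : 0 < μ)
    (V₀ : ℝ → ℝ) (hV₀meas : Measurable V₀)
    (hV₀nonneg : ∀ x, 0 ≤ V₀ x)
    (hV₀singlewell : ∃ c : ℝ, MonotoneOn V₀ (Set.Iic c) ∧ AntitoneOn V₀ (Set.Ici c))
    (g g' : ℝ → ℝ)
    -- g is locally absolutely continuous with a.e. derivative g'
    (hgAC : ∀ a b : ℝ, IntervalIntegrable g' volume a b ∧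
      ∫ x in a..b, g' x = g b - g a)
    (hgeq : ∀ᵐ x : ℝ ∂volume, g' x = μ - V₀ x - g x ^ 2)
    (hgtop : Tendsto g atTop (𝓝 (-Real.sqrt μ)))
    (hgbot : Tendsto g atBot (𝓝 (Real.sqrt μ))) :
    (∀ᵐ x : ℝ ∂volume, g' x ≤ 0) ∧ Antitone g := by
  obtain ⟨c, hmono, hanti⟩ := hV₀singlewell
  have hall : ∀ x, μ - V₀ x - g x ^ 2 ≤ 0 := by
    intro x
    rcases le_total c x with h | h
    · exact half_aux μ V₀ hV₀nonneg c hanti g g' hgAC hgeq hgtop x h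
    · have := half_aux μ (fun x => V₀ (-x)) (fun x => hV₀nonneg _) (-c)
        (by
          intro a ha b hb hab
          have ha : -c ≤ a := ha
          have hb : -c ≤ b := hb
          exact hmono (show -b ≤ c by linarith) (show -a ≤ c by linarith) (by linarith))
        (fun x => -g (-x)) (fun x => g' (-x))
        (by
          intro a b
          refine ⟨?_, ?_⟩
          · simpa using (hgAC (-a) (-b)).1.comp_sub_left 0
          · rw [intervalIntegral.integral_comp_neg, (hgAC _ _).2]; ring)
        (by
          have := (Measure.measurePreserving_neg (volume : Measure ℝ)).quasiMeasurePreserving.ae hgeq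
          filter_upwards [this] with t ht
          rw [ht]; ring)
        ((hgbot.comp tendsto_neg_atTop_atBot).neg) (-x) (by linarith)
      simpa using this
  have hae : ∀ᵐ x : ℝ ∂volume, g' x ≤ 0 := by
    filter_upwards [hgeq] with x hx
    rw [hx]; exact hall x
  refine ⟨hae, ?_⟩
  intro a b hab
  have hi : ∫ x in a..b, g' x ≤ 0 := by
    have : 0 ≤ ∫ x in a..b, -g' x := by
      apply intervalIntegral.integral_nonneg_of_ae hab
      filter_upwards [hae] with t ht
      show 0 ≤ -g' t
      linarith
    rw [intervalIntegral.integral_neg] at this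
    linarith
  rw [(hgAC a b).2] at hi
  linarith
end

section
/- Let V₀ : ℝ → ℝ be non-negative and single-well with (1+|x|)V₀(x) integrable over ℝ. Let μ > 0 and let φ : ℝ → ℝ be a strictly positive function in L²(ℝ), continuously differentiable with φ′ locally absolutely continuous, satisfying −φ″(x) − V₀(x)φ(x) = −μφ(x) for almost every x ∈ ℝ (so φ is the ground state of −d²/dx² − V₀ at its lowest eigenvalue −μ). Then x ↦ log φ(x) is concave on ℝ; equivalently φ′/φ is non-increasing. -/
open MeasureTheory Real Filter Set
open scoped Topology

lemma aux_mono (F F' : ℝ → ℝ) (S : Set ℝ) (hS : S.Countable) (a b : ℝ) (hab : a ≤ b)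
    (hc : Continuous F) (hd : ∀ x ∉ S, HasDerivAt F (F' x) x)
    (hi : IntervalIntegrable F' volume a b) (hn : ∀ x, a ≤ x → 0 ≤ F' x) : F a ≤ F b := by
  have h := MeasureTheory.integral_eq_of_hasDerivAt_off_countable_of_le F F' hab hS
    hc.continuousOn (fun x hx => hd x hx.2) hi
  have h2 : 0 ≤ ∫ x in a..b, F' x :=
    intervalIntegral.integral_nonneg hab (fun x hx => hn x hx.1)
  linarith

lemma aux_L2 (f : ℝ → ℝ) (h : Integrable (fun x => f x ^ 2) volume) (a δ : ℝ) (hδ : 0 < δ)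
    (hf : ∀ x, a ≤ x → δ ≤ f x ^ 2) : False := by
  have h1 : IntegrableOn (fun _ : ℝ => δ) (Ici a) volume := by
    refine Integrable.mono' h.integrableOn aestronglyMeasurable_const ?_
    refine (ae_restrict_iff' measurableSet_Ici).2 (Eventually.of_forall fun x hx => ?_)
    rw [Real.norm_of_nonneg hδ.le]
    exact hf x hx
  rw [integrableOn_const_iff] at h1
  simp [hδ.ne'] at h1

lemma aux_right (V f g : ℝ → ℝ) (S : Set ℝ) (hS : S.Countable) (μ c : ℝ)
    (hanti : AntitoneOn V (Ici c)) (hV : Integrable V volume)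
    (hpos : ∀ x, 0 < f x) (hL2 : Integrable (fun x => f x ^ 2) volume)
    (hfg : ∀ x, HasDerivAt f (g x) x) (hg : Continuous g)
    (hgd : ∀ x ∉ S, HasDerivAt g ((μ - V x) * f x) x) (a : ℝ) (ha : c ≤ a) :
    (μ - V a) * f a ^ 2 ≤ g a ^ 2 := by
  have hfc : Continuous f := continuous_iff_continuousAt.2 fun x => (hfg x).continuousAt
  by_cases hq : μ - V a ≤ 0
  · exact (mul_nonpos_of_nonpos_of_nonneg hq (sq_nonneg _)).trans (sq_nonneg _)
  push Not at hq
  set Q := μ - V a with hQ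
  have hge : ∀ x, a ≤ x → Q ≤ μ - V x := fun x hx => by
    have := hanti (show a ∈ Ici c from ha) (show x ∈ Ici c from ha.trans hx) hx
    simp only [hQ]; linarith
  have hmono : ∀ x y, a ≤ x → x ≤ y → g x ≤ g y := fun x y hx hxy => by
    refine aux_mono g _ S hS x y hxy hg hgd ?_ ?_
    · exact ((intervalIntegrable_const).sub hV.intervalIntegrable).mul_continuousOn
        hfc.continuousOn
    · intro z hz
      exact mul_nonneg (hq.le.trans (hge z (hx.trans hz))) (hpos z).le
  have hneg : ∀ x, a ≤ x → g x ≤ 0 := by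
    intro x hx
    by_contra hcon
    push Not at hcon
    refine aux_L2 f hL2 x (f x ^ 2) (pow_pos (hpos x) 2) fun y hy => ?_
    have : f x ≤ f y := aux_mono f g ∅ countable_empty x y hy hfc (fun z _ => hfg z)
      (hg.intervalIntegrable _ _) (fun z hz => hcon.le.trans (hmono x z hx hz))
    exact pow_le_pow_left₀ (hpos x).le this 2
  by_contra hcon
  push Not at hcon
  refine aux_L2 f hL2 a ((Q * f a ^ 2 - g a ^ 2) / Q) (div_pos (by linarith) hq) fun y hy => ?_
  have hE : Q * f a ^ 2 - g a ^ 2 ≤ Q * f y ^ 2 - g y ^ 2 := by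
    refine aux_mono (fun x => Q * f x ^ 2 - g x ^ 2)
      (fun x => (Q - (μ - V x)) * (2 * f x * g x)) S hS a y hy (by fun_prop) ?_ ?_ ?_
    · intro x hx
      have h := (((hfg x).pow 2).const_mul Q).sub ((hgd x hx).pow 2)
      refine HasDerivAt.congr_deriv h ?_
      push_cast
      ring
    · exact ((intervalIntegrable_const).sub ((intervalIntegrable_const).sub
        hV.intervalIntegrable)).mul_continuousOn (by fun_prop)
    · intro x hx
      have h1 := hge x hx
      have h2 := hneg x hx
      have h3 := hpos x
      have h4 : f x * g x ≤ 0 := mul_nonpos_of_nonneg_of_nonpos h3.le h2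
      exact mul_nonneg_of_nonpos_of_nonpos (by linarith) (by linarith)
  rw [div_le_iff₀ hq]
  nlinarith [sq_nonneg (g y)]

theorem single_well_ground_state_log_concave
    (V₀ : ℝ → ℝ)
    (hV₀nonneg : ∀ x, 0 ≤ V₀ x)
    (hV₀singlewell : ∃ c : ℝ, MonotoneOn V₀ (Set.Iic c) ∧ AntitoneOn V₀ (Set.Ici c))
    (hV₀int : Integrable (fun x => (1 + |x|) * V₀ x) (volume : Measure ℝ))
    (μ : ℝ) (hμ : 0 < μ)
    (φ φ'' : ℝ → ℝ)
    (hpos : ∀ x, 0 < φ x)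
    (hL2 : MemLp φ 2 (volume : Measure ℝ))
    (hC1 : ContDiff ℝ 1 φ)
    -- φ' is locally absolutely continuous with a.e. derivative φ''
    (hAC : ∀ a b : ℝ, IntervalIntegrable φ'' volume a b ∧
      ∫ x in a..b, φ'' x = deriv φ b - deriv φ a)
    (heq : ∀ᵐ x : ℝ ∂volume, -φ'' x - V₀ x * φ x = -μ * φ x) :
    ConcaveOn ℝ Set.univ (fun x => Real.log (φ x)) ∧
      Antitone (fun x => deriv φ x / φ x) := by
  obtain ⟨c, hm, ha⟩ := hV₀singlewell
  have hVm : AEStronglyMeasurable V₀ volume := by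
    have h1 : AEStronglyMeasurable (fun x : ℝ => (1 + |x|)⁻¹ * ((1 + |x|) * V₀ x)) volume := by
      refine AEStronglyMeasurable.mul ?_ hV₀int.1
      exact (Continuous.inv₀ (by fun_prop) (fun x => by positivity)).aestronglyMeasurable
    refine h1.congr (Eventually.of_forall fun x => ?_)
    have : (1 + |x|) ≠ 0 := by positivity
    simp only
    field_simp
  have hV : Integrable V₀ volume := by
    refine hV₀int.mono' hVm (Eventually.of_forall fun x => ?_)
    rw [Real.norm_of_nonneg (hV₀nonneg x)]
    nlinarith [hV₀nonneg x, abs_nonneg x, mul_nonneg (abs_nonneg x) (hV₀nonneg x)]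
  have hfg : ∀ x, HasDerivAt φ (deriv φ x) x := fun x =>
    (hC1.differentiable (by norm_num) x).hasDerivAt
  have hg : Continuous (deriv φ) := hC1.continuous_deriv (by norm_num)
  have hfc : Continuous φ := hC1.continuous
  set S : Set ℝ := {x | ¬ ContinuousAt V₀ x} with hSdef
  have hS : S.Countable := by
    refine ((hm.countable_not_continuousWithinAt.union
      ha.countable_not_continuousWithinAt).union (countable_singleton c)).mono ?_
    intro x hx
    rcases lt_trichotomy x c with h | h | h
    · exact Or.inl (Or.inl ⟨h.le, fun hh => hx (hh.continuousAt (Iic_mem_nhds h))⟩)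
    · exact Or.inr h
    · exact Or.inl (Or.inr ⟨h.le, fun hh => hx (hh.continuousAt (Ici_mem_nhds h))⟩)
  have hgd : ∀ x ∉ S, HasDerivAt (deriv φ) ((μ - V₀ x) * φ x) x := by
    intro x hx
    have hcx : ContinuousAt V₀ x := not_not.1 hx
    have h1 : HasDerivAt (fun u => ∫ t in (0:ℝ)..u, (μ - V₀ t) * φ t) ((μ - V₀ x) * φ x) x := by
      refine intervalIntegral.integral_hasDerivAt_right ?_ ?_ ?_
      · exact ((intervalIntegrable_const).sub hV.intervalIntegrable).mul_continuousOn
          hfc.continuousOn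
      · exact ((aestronglyMeasurable_const.sub hVm).mul
          hfc.aestronglyMeasurable).stronglyMeasurableAtFilter
      · exact (continuousAt_const.sub hcx).mul hfc.continuousAt
    have h2 : deriv φ = fun u => (∫ t in (0:ℝ)..u, (μ - V₀ t) * φ t) + deriv φ 0 := by
      funext u
      have h3 : ∫ t in (0:ℝ)..u, (μ - V₀ t) * φ t = ∫ t in (0:ℝ)..u, φ'' t := by
        refine intervalIntegral.integral_congr_ae ?_
        filter_upwards [heq] with t ht _
        linarith
      rw [h3, (hAC 0 u).2]; ring
    rw [h2]
    exact h1.add_const _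
  have hL : Integrable (fun x => φ x ^ 2) volume := hL2.integrable_sq
  have key : ∀ a, (μ - V₀ a) * φ a ^ 2 ≤ deriv φ a ^ 2 := by
    intro a
    rcases le_total c a with h | h
    · exact aux_right V₀ φ (deriv φ) S hS μ c ha hV hpos hL hfg hg hgd a h
    · have := aux_right (fun x => V₀ (-x)) (fun x => φ (-x)) (fun x => -deriv φ (-x))
        ((fun x => -x) ⁻¹' S) (hS.preimage neg_injective) μ (-c) ?_ hV.comp_neg
        (fun x => hpos _) hL.comp_neg ?_ (by fun_prop) ?_ (-a) (by linarith)
      · simpa using this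
      · intro x hx y hy hxy
        simp only [mem_Ici] at hx hy
        exact hm (show -y ∈ Iic c by simp; linarith) (show -x ∈ Iic c by simp; linarith)
          (by linarith)
      · intro x
        have := (hfg (-x)).comp x (hasDerivAt_neg x)
        simpa [Function.comp_def] using this
      · intro x hx
        have := ((hgd (-x) hx).comp x (hasDerivAt_neg x)).neg
        refine HasDerivAt.congr_deriv this ?_
        ring
  have hanti : Antitone (fun x => deriv φ x / φ x) := by
    intro x y hxy
    have hne : ∀ x, φ x ≠ 0 := fun x => (hpos x).ne'
    have := aux_mono (fun x => -(deriv φ x / φ x))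
      (fun x => (deriv φ x / φ x) ^ 2 - (μ - V₀ x)) S hS x y hxy
      ((hg.div hfc hne).neg) ?_ ?_ ?_
    · simp only at this ⊢; linarith
    · intro z hz
      have h := ((hgd z hz).div (hfg z) (hne z)).neg
      refine HasDerivAt.congr_deriv h ?_
      have := hne z
      field_simp
      ring
    · refine IntervalIntegrable.sub ?_ ((intervalIntegrable_const).sub hV.intervalIntegrable)
      exact ((hg.div hfc hne).pow 2).intervalIntegrable _ _
    · intro z _
      have := key z
      rw [div_pow, sub_nonneg, le_div_iff₀ (pow_pos (hpos z) 2)]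
      exact this
  refine ⟨?_, hanti⟩
  refine Antitone.concaveOn_univ_of_deriv
    (fun x => ((hfg x).log (hpos x).ne').differentiableAt) ?_
  have : deriv (fun x => Real.log (φ x)) = fun x => deriv φ x / φ x :=
    funext fun x => ((hfg x).log (hpos x).ne').deriv
  rw [this]; exact hanti
end

section
/- Let σ ∈ ℝ, let V₀ : (0,∞) → ℝ be non-negative, non-increasing and integrable on (0,∞), let μ > 0, and let φ be a strictly positive function in L²(0,∞), continuously differentiable on [0,∞) with φ′ locally absolutely continuous, satisfying φ′(0) − σφ(0) = 0 and −φ″(r) − V₀(r)φ(r) = −μφ(r) for almost every r ∈ (0,∞) (so φ is the ground state of the Robin Schrödinger operator −d²/dr² − V₀ at its lowest eigenvalue −μ). Then r ↦ log φ(r) is concave on (0,∞); equivalently φ′/φ is non-increasing on (0,∞). -/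
open MeasureTheory Real Filter Set
open scoped Topology


theorem aux_mono_s14 {f d : ℝ → ℝ} {a b : ℝ} (hab : a ≤ b)
    (hf : AbsolutelyContinuousOnInterval f a b)
    (hd : ∀ᵐ x, x ∈ Set.Icc a b → HasDerivAt f (d x) x ∧ 0 ≤ d x) : f a ≤ f b := by
  have h := hf.integral_deriv_eq_sub
  have h2 : 0 ≤ ∫ x in a..b, deriv f x := by
    apply intervalIntegral.integral_nonneg_of_ae_restrict hab
    rw [Filter.EventuallyLE, ae_restrict_iff' measurableSet_Icc]
    filter_upwards [hd] with x hx hxm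
    rw [(hx hxm).1.deriv]
    exact (hx hxm).2
  linarith

theorem aux_exp (k : ℝ) (x : ℝ) : HasDerivAt (fun r => Real.exp (k * r)) (k * Real.exp (k * x)) x := by
  have := ((hasDerivAt_id x).const_mul k).exp
  simpa [mul_comm] using this

theorem aux_exp_ac (k a b : ℝ) : AbsolutelyContinuousOnInterval (fun r => Real.exp (k * r)) a b := by
  apply ContDiffOn.absolutelyContinuousOnInterval
  fun_prop

theorem aux_growth (V₀ φ q : ℝ → ℝ) (μ : ℝ)
    (hmono : AntitoneOn V₀ (Set.Ioi 0))
    (hpos : ∀ r ∈ Set.Ici (0 : ℝ), 0 < φ r)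
    (hL2 : MemLp φ 2 (volume.restrict (Set.Ioi (0 : ℝ))))
    (hφ : ∀ x, 0 < x → HasDerivAt φ (q x) x)
    (hφac : ∀ a b, 0 < a → a ≤ b → AbsolutelyContinuousOnInterval φ a b)
    (hqac : ∀ a b, 0 < a → a ≤ b → AbsolutelyContinuousOnInterval q a b)
    (hq : ∀ a b, 0 < a → a ≤ b → ∀ᵐ x, x ∈ Set.Icc a b → HasDerivAt q ((μ - V₀ x) * φ x) x)
    (s : ℝ) (hs : 0 < s) : (μ - V₀ s) * φ s ^ 2 ≤ q s ^ 2 := by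
  have hφs := hpos s hs.le
  by_cases hW : μ - V₀ s ≤ 0
  · nlinarith [sq_nonneg (q s), sq_nonneg (φ s)]
  push Not at hW
  set w := Real.sqrt (μ - V₀ s) with hw
  have hw0 : 0 < w := Real.sqrt_pos.2 hW
  have hw2 : w ^ 2 = μ - V₀ s := Real.sq_sqrt hW.le
  by_cases hp : q s + w * φ s ≤ 0
  · rw [← hw2]
    have : 0 < w * φ s := by positivity
    nlinarith
  push Not at hp
  exfalso
  have h1 : ∀ r, s ≤ r → Real.exp (-w * s) * (q s + w * φ s) ≤ Real.exp (-w * r) * (q r + w * φ r) := by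
    intro r hr
    refine aux_mono_s14 (f := fun r => Real.exp (-w * r) * (q r + w * φ r))
      (d := fun x => Real.exp (-w * x) * ((μ - V₀ x - w ^ 2) * φ x)) hr ?_ ?_
    · exact (aux_exp_ac _ _ _).fun_mul ((hqac s r hs hr).fun_add ((hφac s r hs hr).const_mul w))
    · filter_upwards [hq s r hs hr] with x hx hxm
      have hx0 : 0 < x := hs.trans_le hxm.1
      constructor
      · have := (aux_exp (-w) x).mul ((hx hxm).add ((hφ x hx0).const_mul w))
        refine HasDerivAt.congr_deriv this ?_
        simp only [Pi.add_apply]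
        ring
      · have := hmono (mem_Ioi.2 hs) (mem_Ioi.2 hx0) hxm.1
        have := hpos x hx0.le
        rw [hw2]
        apply mul_nonneg (Real.exp_pos _).le (mul_nonneg (by linarith) this.le)
  set δ := min (Real.exp (-w * s) * (q s + w * φ s) / (2 * w)) (Real.exp (-w * s) * φ s) with hδ
  have hδ0 : 0 < δ := by
    apply lt_min <;> positivity
  have hδ1 : 2 * w * δ ≤ Real.exp (-w * s) * (q s + w * φ s) := by
    have := min_le_left (Real.exp (-w * s) * (q s + w * φ s) / (2 * w)) (Real.exp (-w * s) * φ s)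
    rw [← hδ, le_div_iff₀ (by positivity)] at this
    linarith
  have hδ2 : δ ≤ Real.exp (-w * s) * φ s := min_le_right _ _
  have e1 : ∀ r, Real.exp (w * r) * Real.exp (-w * r) = 1 := by
    intro r; rw [← Real.exp_add]; simp
  have e2 : ∀ r, Real.exp (2 * w * r) = Real.exp (w * r) * Real.exp (w * r) := by
    intro r; rw [← Real.exp_add]; ring_nf
  have h2 : ∀ r, s ≤ r → δ ≤ φ r := by
    intro r hr
    have key : Real.exp (w * s) * φ s - δ * Real.exp (2 * w * s) ≤
        Real.exp (w * r) * φ r - δ * Real.exp (2 * w * r) := by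
      refine aux_mono_s14 (f := fun r => Real.exp (w * r) * φ r - δ * Real.exp (2 * w * r))
        (d := fun x => Real.exp (w * x) * (q x + w * φ x) - δ * (2 * w * Real.exp (2 * w * x))) hr ?_ ?_
      · exact ((aux_exp_ac _ _ _).fun_mul (hφac s r hs hr)).fun_sub ((aux_exp_ac _ _ _).const_mul δ)
      · refine Filter.Eventually.of_forall fun x hxm => ?_
        have hx0 : 0 < x := hs.trans_le hxm.1
        constructor
        · have := ((aux_exp w x).mul (hφ x hx0)).sub ((aux_exp (2 * w) x).const_mul δ)
          refine HasDerivAt.congr_deriv this ?_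
          ring
        · have h3 := hδ1.trans (h1 x hxm.1)
          have h4 := mul_le_mul_of_nonneg_left h3 (mul_pos (Real.exp_pos (w*x)) (Real.exp_pos (w*x))).le
          have h5 : Real.exp (w * x) * Real.exp (w * x) * (Real.exp (-w * x) * (q x + w * φ x))
              = Real.exp (w * x) * (q x + w * φ x) := by
            linear_combination (Real.exp (w * x) * (q x + w * φ x)) * e1 x
          rw [e2]
          linarith
    have h6 : 0 ≤ Real.exp (w * s) * φ s - δ * Real.exp (2 * w * s) := by
      have h4 := mul_le_mul_of_nonneg_left hδ2 (mul_pos (Real.exp_pos (w*s)) (Real.exp_pos (w*s))).le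
      have h5 : Real.exp (w * s) * Real.exp (w * s) * (Real.exp (-w * s) * φ s)
              = Real.exp (w * s) * φ s := by
            linear_combination (Real.exp (w * s) * φ s) * e1 s
      rw [e2]
      linarith
    have h7 : δ * Real.exp (w * r) ≤ φ r := by
      have h8 := h6.trans key
      rw [e2] at h8
      have := Real.exp_pos (w * r)
      by_contra hcon
      push Not at hcon
      nlinarith
    have h9 : 1 ≤ Real.exp (w * r) := Real.one_le_exp (by nlinarith)
    nlinarith
  have hint : IntegrableOn (fun x => φ x ^ 2) (Set.Ioi s) := by
    have := hL2.integrable_sq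
    exact IntegrableOn.mono_set this (Set.Ioi_subset_Ioi hs.le)
  have hc : IntegrableOn (fun _ : ℝ => δ ^ 2) (Set.Ioi s) := by
    refine Integrable.mono' hint (by fun_prop) ?_
    refine (ae_restrict_iff' measurableSet_Ioi).2 (Filter.Eventually.of_forall fun x hx => ?_)
    have := h2 x (le_of_lt hx)
    rw [Real.norm_eq_abs, abs_of_pos (by positivity)]
    gcongr
  rw [integrableOn_const_iff] at hc
  simp at hc
  exact hδ0.ne' hc

theorem robin_ground_state_log_concave
    (σ : ℝ) (V₀ : ℝ → ℝ)
    (hV₀nonneg : ∀ r ∈ Set.Ioi (0 : ℝ), 0 ≤ V₀ r)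
    (hV₀mono : AntitoneOn V₀ (Set.Ioi 0))
    (hV₀int : IntegrableOn V₀ (Set.Ioi 0) volume)
    (μ : ℝ) (hμ : 0 < μ)
    (φ φ'' : ℝ → ℝ)
    (hpos : ∀ r ∈ Set.Ici (0 : ℝ), 0 < φ r)
    (hL2 : MemLp φ 2 (volume.restrict (Set.Ioi (0 : ℝ))))
    (hC1 : ContDiffOn ℝ 1 φ (Set.Ici 0))
    -- φ' is locally absolutely continuous on [0,∞) with a.e. derivative φ''
    (hAC : ∀ a b : ℝ, 0 ≤ a → 0 ≤ b → IntervalIntegrable φ'' volume a b ∧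
      ∫ r in a..b, φ'' r = derivWithin φ (Set.Ici 0) b - derivWithin φ (Set.Ici 0) a)
    (hbc : derivWithin φ (Set.Ici 0) 0 - σ * φ 0 = 0)
    (heq : ∀ᵐ r ∂(volume.restrict (Set.Ioi (0 : ℝ))), -φ'' r - V₀ r * φ r = -μ * φ r) :
    ConcaveOn ℝ (Set.Ioi 0) (fun r => Real.log (φ r)) ∧
      AntitoneOn (fun r => deriv φ r / φ r) (Set.Ioi 0) := by
  set D := derivWithin φ (Set.Ici 0) with hD
  let q : ℝ → ℝ := fun x => D 0 + ∫ r in (0:ℝ)..x, φ'' r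
  have hqD : ∀ x, 0 ≤ x → q x = D x := by
    intro x hx
    have := (hAC 0 x le_rfl hx).2
    simp only [q]
    linarith
  have hφ : ∀ x, 0 < x → HasDerivAt φ (q x) x := by
    intro x hx
    have h1 : DifferentiableWithinAt ℝ φ (Set.Ici 0) x :=
      (hC1.differentiableOn (by norm_num)) x hx.le
    rw [hqD x hx.le]
    exact h1.hasDerivWithinAt.hasDerivAt (Ici_mem_nhds hx)
  have hsub : ∀ a b : ℝ, 0 < a → a ≤ b → Set.uIcc a b ⊆ Set.Ici 0 := by
    intro a b ha hab x hx
    rw [Set.uIcc_of_le hab] at hx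
    exact ha.le.trans hx.1
  have hφac : ∀ a b, 0 < a → a ≤ b → AbsolutelyContinuousOnInterval φ a b := fun a b ha hab =>
    (hC1.mono (hsub a b ha hab)).absolutelyContinuousOnInterval
  have hconst : ∀ c a b : ℝ, AbsolutelyContinuousOnInterval (fun _ : ℝ => c) a b := fun c a b =>
    ContDiffOn.absolutelyContinuousOnInterval contDiffOn_const
  have hqac : ∀ a b, 0 < a → a ≤ b → AbsolutelyContinuousOnInterval q a b := by
    intro a b ha hab
    have h0 := ((hAC 0 b le_rfl (ha.le.trans hab)).1.absolutelyContinuousOnInterval_intervalIntegral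
      (c := 0) (by simp))
    refine (hconst (D 0) a b).fun_add (h0.mono ?_)
    rw [Set.uIcc_of_le hab, Set.uIcc_of_le (ha.le.trans hab)]
    exact Set.Icc_subset_Icc_left ha.le
  have hq : ∀ a b, 0 < a → a ≤ b → ∀ᵐ x, x ∈ Set.Icc a b →
      HasDerivAt q ((μ - V₀ x) * φ x) x := by
    intro a b ha hab
    have heq' := (ae_restrict_iff' measurableSet_Ioi).1 heq
    filter_upwards [(hAC 0 b le_rfl (ha.le.trans hab)).1.ae_hasDerivAt_integral, heq'] with x hx hx2 hxm
    have hx0 : 0 < x := ha.trans_le hxm.1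
    have h1 := hx (by rw [Set.uIcc_of_le (ha.le.trans hab)]; exact ⟨hx0.le, hxm.2⟩) 0 (by simp)
    have h2 : φ'' x = (μ - V₀ x) * φ x := by linarith [hx2 hx0]
    rw [← h2]
    exact h1.const_add (D 0)
  have key := aux_growth V₀ φ q μ hV₀mono hpos hL2 hφ hφac hqac hq
  have hanti : AntitoneOn (fun r => deriv φ r / φ r) (Set.Ioi 0) := by
    intro a ha b hb hab
    simp only [(hφ a ha).deriv, (hφ b hb).deriv]
    have hne : ∀ x ∈ Set.uIcc a b, φ x ≠ 0 := fun x hx => (hpos x (hsub a b ha hab hx)).ne'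
    have hinv : AbsolutelyContinuousOnInterval (fun x => (φ x)⁻¹) a b :=
      ((hC1.mono (hsub a b ha hab)).inv hne).absolutelyContinuousOnInterval
    have := aux_mono_s14 (f := fun r => -(q r * (φ r)⁻¹))
      (d := fun x => (q x ^ 2 - (μ - V₀ x) * φ x ^ 2) / φ x ^ 2) hab
      ((hqac a b ha hab).fun_mul hinv).fun_neg ?_
    · simp only [div_eq_mul_inv]
      linarith
    · filter_upwards [hq a b ha hab] with x hx hxm
      have hx0 : 0 < x := lt_of_lt_of_le ha hxm.1
      have hp := hpos x hx0.le
      constructor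
      · have := ((hx hxm).mul ((hφ x hx0).inv hp.ne')).neg
        refine HasDerivAt.congr_deriv this ?_
        simp only [Pi.inv_apply]
        field_simp
        ring
      · have := key x hx0
        apply div_nonneg (by linarith) (by positivity)
  refine ⟨?_, hanti⟩
  have hlog : ∀ x, 0 < x → HasDerivAt (fun r => Real.log (φ r)) (q x / φ x) x := fun x hx =>
    (hφ x hx).log (hpos x hx.le).ne'
  apply AntitoneOn.concaveOn_of_deriv (convex_Ioi 0)
  · exact fun x hx => (hlog x hx).continuousAt.continuousWithinAt
  · rw [interior_Ioi]
    exact fun x hx => (hlog x hx).differentiableAt.differentiableWithinAt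
  · rw [interior_Ioi]
    refine hanti.congr fun x hx => ?_
    simp only [(hlog x hx).deriv, (hφ x hx).deriv]
end

section
/- Let λ > 0 and let h : ℝ → ℝ be continuous with lim_{x→+∞} h(x) = −√λ. If ψ : ℝ → ℝ is differentiable, not identically zero, and satisfies ψ′(x) = −h(x)ψ(x) for all x ∈ ℝ, then ψ ∉ L²(ℝ). -/
open MeasureTheory Real Filter Set
open scoped Topology

theorem solution_of_first_order_ode_not_square_integrable
    (lam : ℝ) (hlam : 0 < lam)
    (h ψ : ℝ → ℝ)
    (hc : Continuous h)
    (hlim : Tendsto h atTop (𝓝 (-Real.sqrt lam)))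
    (hψdiff : Differentiable ℝ ψ)
    (hψne : ψ ≠ 0)
    (hode : ∀ x : ℝ, deriv ψ x = -h x * ψ x) :
    ¬ MemLp ψ 2 (volume : Measure ℝ) := by
  intro hL
  have hd : ∀ x, HasDerivAt ψ (-h x * ψ x) x := fun x => by
    rw [← hode x]; exact (hψdiff x).hasDerivAt
  have hH : ∀ x, HasDerivAt (fun x => ∫ t in (0:ℝ)..x, h t) (h x) x := fun x =>
    intervalIntegral.integral_hasDerivAt_right (hc.intervalIntegrable _ _)
      (hc.stronglyMeasurableAtFilter _ _) hc.continuousAt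
  have hP : ∀ x, HasDerivAt (fun x => ψ x * Real.exp (∫ t in (0:ℝ)..x, h t)) 0 x := fun x => by
    have := (hd x).mul (hH x).exp
    exact this.congr_deriv (by ring)
  have hconst : ∀ x y, ψ x * Real.exp (∫ t in (0:ℝ)..x, h t)
      = ψ y * Real.exp (∫ t in (0:ℝ)..y, h t) :=
    is_const_of_deriv_eq_zero (fun x => (hP x).differentiableAt) (fun x => (hP x).deriv)
  obtain ⟨x0, hx0⟩ := Function.ne_iff.mp hψne
  have hne : ∀ x, ψ x ≠ 0 := fun x hx => by
    have := hconst x0 x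
    rw [hx, zero_mul] at this
    exact (mul_ne_zero hx0 (Real.exp_ne_zero _)) this
  have hneg : -Real.sqrt lam < 0 := neg_lt_zero.mpr (Real.sqrt_pos.mpr hlam)
  obtain ⟨X, hX⟩ := eventually_atTop.mp (hlim.eventually_lt_const hneg)
  have hd2 : ∀ x, HasDerivAt (fun x => ψ x ^ 2) (-2 * h x * ψ x ^ 2) x := fun x => by
    have := (hd x).pow 2
    exact this.congr_deriv (by push_cast; ring)
  have hmono : MonotoneOn (fun x => ψ x ^ 2) (Ici X) := by
    apply monotoneOn_of_deriv_nonneg (convex_Ici X)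
    · exact (hψdiff.continuous.pow 2).continuousOn
    · exact fun x _ => (hd2 x).differentiableAt.differentiableWithinAt
    · intro x hx
      rw [interior_Ici] at hx
      rw [(hd2 x).deriv]
      have := hX x (le_of_lt hx)
      have : 0 ≤ -2 * h x := by linarith
      positivity
  have hint : IntegrableOn (fun x => ψ x ^ 2) (Ici X) := hL.integrable_sq.integrableOn
  have hci : IntegrableOn (fun _ : ℝ => ψ X ^ 2) (Ici X) := by
    refine Integrable.mono' hint aestronglyMeasurable_const ?_
    refine (ae_restrict_iff' measurableSet_Ici).mpr (ae_of_all _ fun x hx => ?_)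
    rw [Real.norm_of_nonneg (sq_nonneg _)]
    exact hmono self_mem_Ici hx hx
  rw [integrableOn_const_iff (by simp)] at hci
  rcases hci with h0 | h1
  · exact pow_ne_zero 2 (hne X) (enorm_eq_zero.mp h0)
  · simp at h1
end

section
/- Let ν > −1/2 and κ > 0. Then: (i) the function u(r) = r^{ν+1} e^{−κr/(2(ν+1))} is strictly positive on (0,∞), belongs to L²(0,∞), satisfies lim_{r→0⁺} u(r) = 0, and solves −u″(r) + (ν(ν+1)/r² − κ/r) u(r) = −(κ²/(4(ν+1)²)) u(r) for all r ∈ (0,∞); (ii) for every integer k ≥ 1, the number −κ²/(4(ν+k)²) is a Dirichlet eigenvalue of the Coulomb operator −d²/dr² + ν(ν+1)/r² − κ/r on L²(0,∞). -/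
open MeasureTheory Real Filter Set
open scoped Topology

/-- `E` is a Dirichlet eigenvalue of `-d²/dr² - W` on `L²(0,∞)`: there is a
nonzero `ψ ∈ L²(0,∞)`, continuously differentiable on `(0,∞)` with `ψ'` locally
absolutely continuous (encoded via a locally integrable a.e.-derivative `ψ''`),
with `ψ(r) → 0` as `r → 0⁺` and `-ψ'' - Wψ = Eψ` a.e. on `(0,∞)`. -/
def IsDirichletEigenvalue (W : ℝ → ℝ) (E : ℝ) : Prop :=
  ∃ ψ ψ'' : ℝ → ℝ,
    ¬ (∀ᵐ r ∂(volume.restrict (Set.Ioi (0 : ℝ))), ψ r = 0) ∧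
    MemLp ψ 2 (volume.restrict (Set.Ioi (0 : ℝ))) ∧
    ContDiffOn ℝ 1 ψ (Set.Ioi 0) ∧
    (∀ a b : ℝ, 0 < a → 0 < b → IntervalIntegrable ψ'' volume a b ∧
      ∫ r in a..b, ψ'' r = deriv ψ b - deriv ψ a) ∧
    Filter.Tendsto ψ (nhdsWithin 0 (Set.Ioi 0)) (nhds 0) ∧
    (∀ᵐ r ∂(volume.restrict (Set.Ioi (0 : ℝ))), -ψ'' r - W r * ψ r = E * ψ r)

open Polynomial in
noncomputable def GG (a β : ℝ) (p : ℝ[X]) (r : ℝ) : ℝ := r ^ a * Real.exp (-(β * r)) * p.eval r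

open Polynomial in
noncomputable def DD (a β : ℝ) (p : ℝ[X]) : ℝ[X] := C a * p - C β * X * p + X * derivative p

open Polynomial in
lemma GG_hasDeriv (a β : ℝ) (p : ℝ[X]) {r : ℝ} (hr : 0 < r) :
    HasDerivAt (GG a β p) (GG (a - 1) β (DD a β p) r) r := by
  have h1 : HasDerivAt (fun r : ℝ => r ^ a) (a * r ^ (a - 1)) r :=
    Real.hasDerivAt_rpow_const (Or.inl hr.ne')
  have h2 : HasDerivAt (fun r : ℝ => Real.exp (-(β * r))) (Real.exp (-(β * r)) * (-(β * 1))) r :=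
    (((hasDerivAt_id r).const_mul β).neg).exp
  have h3 := (h1.mul h2).mul (p.hasDerivAt r)
  refine h3.congr_deriv ?_
  have h4 : r ^ a = r ^ (a - 1) * r := by
    rw [Real.rpow_sub_one hr.ne']; field_simp
  simp only [GG, DD, Pi.mul_apply, eval_add, eval_sub, eval_mul, eval_C, eval_X]
  rw [h4]
  ring

open Polynomial in
lemma GG_cont (a β : ℝ) (p : ℝ[X]) : ContinuousOn (GG a β p) (Ioi 0) := fun _ hr =>
  (GG_hasDeriv a β p hr).continuousAt.continuousWithinAt

open Polynomial in
lemma GG_deriv_eventually (a β : ℝ) (p : ℝ[X]) {r : ℝ} (hr : 0 < r) :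
    deriv (GG a β p) =ᶠ[𝓝 r] GG (a - 1) β (DD a β p) := by
  filter_upwards [Ioi_mem_nhds hr] with s hs
  exact (GG_hasDeriv a β p hs).deriv

open Polynomial in
lemma GG_tendsto {a : ℝ} (ha : 0 < a) (β : ℝ) (p : ℝ[X]) :
    Tendsto (GG a β p) (𝓝[>] 0) (𝓝 0) := by
  have h : ContinuousAt (GG a β p) 0 := by
    unfold GG
    have h1 : ContinuousAt (fun r : ℝ => r ^ a) 0 :=
      Real.continuousAt_rpow_const 0 a (Or.inr ha.le)
    have h2 : Continuous (fun r : ℝ => Real.exp (-(β * r))) := by fun_prop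
    exact (h1.mul h2.continuousAt).mul p.continuous.continuousAt
  have h0 : GG a β p 0 = 0 := by simp [GG, Real.zero_rpow ha.ne']
  have := h.tendsto
  rw [h0] at this
  exact this.mono_left nhdsWithin_le_nhds

open Polynomial in
lemma GG_integrable {a β : ℝ} (ha : -1 < a) (hβ : 0 < β) (p : ℝ[X]) :
    IntegrableOn (GG a β p) (Ioi 0) := by
  induction p using Polynomial.induction_on' with
  | add p q hp hq =>
    refine (hp.add hq).congr_fun (fun r _ => ?_) measurableSet_Ioi
    simp [GG, mul_add]
  | monomial n c =>
    have h := (integrableOn_rpow_mul_exp_neg_mul_rpow (p := 1) (s := a + n) (b := β)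
      (by have : (0:ℝ) ≤ n := n.cast_nonneg
          linarith) one_pos hβ).const_mul c
    refine IntegrableOn.congr_fun h (fun r hr => ?_) measurableSet_Ioi
    have hr : 0 < r := hr
    simp only [GG, eval_monomial, Real.rpow_one, Real.rpow_add hr, Real.rpow_natCast, neg_mul]
    ring

open Polynomial in
lemma GG_memLp {a β : ℝ} (ha : 0 < a) (hβ : 0 < β) (p : ℝ[X]) :
    MemLp (GG a β p) 2 (volume.restrict (Ioi 0)) := by
  rw [memLp_two_iff_integrable_sq ((GG_cont a β p).aestronglyMeasurable measurableSet_Ioi)]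
  have h := GG_integrable (a := 2 * a) (β := 2 * β) (by linarith) (by linarith) (p ^ 2)
  refine IntegrableOn.congr_fun h (fun r hr => ?_) measurableSet_Ioi
  have hr : 0 < r := hr
  have e1 : r ^ (2 * a) = (r ^ a) ^ 2 := by
    rw [mul_comm, Real.rpow_mul hr.le]; norm_cast
  have e2 : Real.exp (-(2 * β * r)) = Real.exp (-(β * r)) ^ 2 := by
    rw [← Real.exp_nat_mul]; congr 1; push_cast; ring
  simp only [GG, eval_pow, e1, e2]
  ring

open Polynomial in
lemma GG_ode (ν β κ : ℝ) (n : ℕ) (p : ℝ[X]) (hκ : κ = 2 * β * (ν + 1 + n))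
    (hp : X * derivative (derivative p) + (C (2 * ν + 2) - C (2 * β) * X) * derivative p
      + C (2 * β * n) * p = 0) {r : ℝ} (hr : 0 < r) :
    GG (ν + 1 - 1 - 1) β (DD (ν + 1 - 1) β (DD (ν + 1) β p)) r =
      (ν * (ν + 1) / r ^ 2 - κ / r + β ^ 2) * GG (ν + 1) β p r := by
  have h := congrArg (eval r) hp
  simp only [eval_add, eval_sub, eval_mul, eval_C, eval_X, eval_zero] at h
  have e1 : r ^ (ν + 1) = r ^ (ν + 1 - 1 - 1) * r ^ 2 := by
    rw [Real.rpow_sub_one hr.ne', Real.rpow_sub_one hr.ne']; field_simp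
  simp only [GG, DD]
  rw [e1]
  generalize r ^ (ν + 1 - 1 - 1) = A
  generalize Real.exp (-(β * r)) = B
  simp only [derivative_add, derivative_sub, derivative_mul, derivative_C, derivative_X,
    eval_add, eval_sub, eval_mul, eval_C, eval_X, eval_zero, eval_one]
  generalize eval r (derivative (derivative p)) = p2 at *
  generalize eval r (derivative p) = p1 at *
  generalize eval r p = p0 at *
  subst hκ
  field_simp
  linear_combination (A * B * r) * h

noncomputable def cc (ν β : ℝ) (n : ℕ) : ℕ → ℝ
  | 0 => 1
  | j + 1 => 2 * β * ((j : ℝ) - n) / ((j + 1) * (j + 2 * ν + 2)) * cc ν β n j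

lemma cc_zero (ν β : ℝ) (n j : ℕ) : cc ν β n (n + 1 + j) = 0 := by
  induction j with
  | zero => simp [cc]
  | succ j ih => rw [← add_assoc, cc, ih, mul_zero]

open Polynomial in
lemma exists_poly (ν β : ℝ) (hν : -(1 / 2) < ν) (n : ℕ) : ∃ p : ℝ[X], p ≠ 0 ∧
    X * derivative (derivative p) + (C (2 * ν + 2) - C (2 * β) * X) * derivative p
      + C (2 * β * n) * p = 0 := by
  let p : ℝ[X] := ∑ j ∈ Finset.range (n + 1), C (cc ν β n j) * X ^ j
  have hc : ∀ j, p.coeff j = cc ν β n j := by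
    intro j
    simp only [p, finsetSum_coeff, coeff_C_mul, coeff_X_pow, mul_ite, mul_one, mul_zero,
      Finset.sum_ite_eq, Finset.mem_range]
    split_ifs with h
    · rfl
    · obtain ⟨m, rfl⟩ := Nat.exists_eq_add_of_le (not_lt.mp h)
      exact (cc_zero ν β n m).symm
  refine ⟨p, fun h => ?_, ?_⟩
  · have := hc 0
    rw [h] at this
    simp [cc] at this
  · ext j
    have hs : cc ν β n (j + 1) * ((j + 1) * (j + 2 * ν + 2)) =
        2 * β * ((j : ℝ) - n) * cc ν β n j := by
      have hj : (0:ℝ) ≤ j := j.cast_nonneg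
      have h1 : (j : ℝ) + 1 ≠ 0 := by positivity
      have h2 : (j : ℝ) + 2 * ν + 2 ≠ 0 := by linarith
      rw [cc]; field_simp
    rw [sub_mul, mul_assoc (C (2 * β))]
    cases j with
    | zero =>
      simp only [coeff_add, coeff_sub, coeff_C_mul, coeff_X_mul_zero, coeff_derivative, hc,
        coeff_zero]
      push_cast at hs ⊢
      linear_combination hs
    | succ j =>
      simp only [coeff_add, coeff_sub, coeff_C_mul, coeff_X_mul, coeff_derivative, hc,
        coeff_zero]
      push_cast at hs ⊢
      linear_combination hs

theorem coulomb_explicit_factorisation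
    (ν κ : ℝ) (hν : -(1 / 2) < ν) (hκ : 0 < κ) :
    -- (i) the ground state u(r) = r^(ν+1) e^(-κr/(2(ν+1)))
    ((∀ r ∈ Set.Ioi (0 : ℝ),
        0 < r ^ (ν + 1) * Real.exp (-κ * r / (2 * (ν + 1)))) ∧
      MemLp (fun r : ℝ => r ^ (ν + 1) * Real.exp (-κ * r / (2 * (ν + 1)))) 2
        (volume.restrict (Set.Ioi (0 : ℝ))) ∧
      Tendsto (fun r : ℝ => r ^ (ν + 1) * Real.exp (-κ * r / (2 * (ν + 1))))
        (nhdsWithin 0 (Set.Ioi 0)) (nhds 0) ∧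
      (∀ r ∈ Set.Ioi (0 : ℝ),
        -(deriv (deriv (fun s : ℝ => s ^ (ν + 1) * Real.exp (-κ * s / (2 * (ν + 1))))) r)
            + (ν * (ν + 1) / r ^ 2 - κ / r)
              * (r ^ (ν + 1) * Real.exp (-κ * r / (2 * (ν + 1))))
          = -(κ ^ 2 / (4 * (ν + 1) ^ 2))
              * (r ^ (ν + 1) * Real.exp (-κ * r / (2 * (ν + 1)))))) ∧
    -- (ii) the Dirichlet eigenvalues of the Coulomb operator
    (∀ k : ℕ, 1 ≤ k →
      IsDirichletEigenvalue (fun r => -(ν * (ν + 1) / r ^ 2) + κ / r)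
        (-(κ ^ 2 / (4 * (ν + (k : ℝ)) ^ 2)))) := by
  have ha : 0 < ν + 1 := by linarith
  have hu : (fun r : ℝ => r ^ (ν + 1) * Real.exp (-κ * r / (2 * (ν + 1)))) =
      GG (ν + 1) (κ / (2 * (ν + 1))) 1 := by
    funext r
    simp only [GG, Polynomial.eval_one, mul_one]
    congr 2; ring
  have hu' := fun r => congrFun hu r
  refine ⟨⟨fun r hr => mul_pos (Real.rpow_pos_of_pos hr _) (Real.exp_pos _), ?_, ?_, ?_⟩, ?_⟩
  · rw [hu]; exact GG_memLp ha (by positivity) 1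
  · rw [hu]; exact GG_tendsto ha _ 1
  · intro r hr
    have hr : 0 < r := hr
    rw [hu, hu', (GG_deriv_eventually _ _ _ hr).deriv_eq, (GG_hasDeriv _ _ _ hr).deriv,
      GG_ode ν (κ / (2 * (ν + 1))) κ 0 1 (by push_cast; field_simp; ring) (by simp) hr]
    field_simp
    ring
  · intro k hk
    obtain ⟨n, rfl⟩ := Nat.exists_eq_add_of_le hk
    have hn : (0:ℝ) ≤ n := n.cast_nonneg
    have hk' : 0 < ν + ((1 + n : ℕ) : ℝ) := by push_cast; linarith
    obtain ⟨β, hβ⟩ : ∃ β, β = κ / (2 * (ν + ((1 + n : ℕ) : ℝ))) := ⟨_, rfl⟩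
    have hβ0 : 0 < β := by rw [hβ]; positivity
    have hE : κ ^ 2 / (4 * (ν + ((1 + n : ℕ) : ℝ)) ^ 2) = β ^ 2 := by
      rw [hβ]; field_simp; ring
    have hκβ : κ = 2 * β * (ν + 1 + n) := by
      have : ν + 1 + n = ν + ((1 + n : ℕ) : ℝ) := by push_cast; ring
      rw [this, hβ]; field_simp
    obtain ⟨p, hp0, hp⟩ := exists_poly ν β hν n
    rw [hE]
    refine ⟨GG (ν + 1) β p, GG (ν + 1 - 1 - 1) β (DD (ν + 1 - 1) β (DD (ν + 1) β p)),
      ?_, GG_memLp ha hβ0 p, ?_, ?_, GG_tendsto ha β p, ?_⟩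
    · intro h
      have hz : volume {r : ℝ | p.IsRoot r} = 0 :=
        (Polynomial.finite_setOf_isRoot hp0).measure_zero _
      have hz' : ∀ᵐ r ∂(volume.restrict (Set.Ioi (0 : ℝ))), ¬ p.IsRoot r :=
        ae_restrict_of_ae (by rw [ae_iff]; simpa using hz)
      have hF : ∀ᵐ r ∂(volume.restrict (Set.Ioi (0 : ℝ))), False := by
        filter_upwards [h, hz', ae_restrict_mem measurableSet_Ioi] with r h1 h2 h3
        have h3 : 0 < r := h3
        have h4 : 0 < r ^ (ν + 1) := Real.rpow_pos_of_pos h3 _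
        exact mul_ne_zero (mul_ne_zero h4.ne' (Real.exp_pos _).ne') h2 h1
      rw [ae_iff] at hF
      simp at hF
    · have : ContDiffOn ℝ (0 + 1) (GG (ν + 1) β p) (Ioi 0) := by
        rw [contDiffOn_succ_iff_deriv_of_isOpen isOpen_Ioi]
        refine ⟨fun r hr => (GG_hasDeriv _ _ _ hr).differentiableAt.differentiableWithinAt,
          by simp, ?_⟩
        rw [contDiffOn_zero]
        exact (GG_cont _ β _).congr fun r hr => (GG_hasDeriv _ _ _ hr).deriv
      simpa using this
    · intro a b h1 h2
      have hsub : uIcc a b ⊆ Ioi 0 := fun x hx => lt_of_lt_of_le (lt_min h1 h2) hx.1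
      have hint := ((GG_cont (ν + 1 - 1 - 1) β
        (DD (ν + 1 - 1) β (DD (ν + 1) β p))).mono hsub).intervalIntegrable (μ := volume)
      refine ⟨hint, ?_⟩
      rw [(GG_hasDeriv _ _ _ h1).deriv, (GG_hasDeriv _ _ _ h2).deriv]
      exact intervalIntegral.integral_eq_sub_of_hasDerivAt
        (fun x hx => GG_hasDeriv _ _ _ (hsub hx)) hint
    · filter_upwards [ae_restrict_mem measurableSet_Ioi] with r hr
      rw [GG_ode ν β κ n p hκβ hp hr]
      ring
end
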